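/- arXiv:1308.6607 — 8 statements merged into one kernel-verified Lean document; each statement's English description precedes it below -/
import Mathlib

section
/- Let s ≥ t > 0. Then the convolution of the measures G(s) and G(t) on ℝ³ is absolutely continuous with respect to Lebesgue measure, with density (G(s)*G(t))(dx) = (8π|x|)⁻¹ 𝟙_{[s−t, s+t]}(|x|) dx; that is, for every nonnegative measurable φ : ℝ³ → ℝ, ∫_{ℝ³}∫_{ℝ³} φ(x+y) G(s,dx) G(t,dy) = ∫_{ℝ³} φ(z) (8π|z|)⁻¹ 𝟙_{s−t ≤ |z| ≤ s+t} dz. -/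
open MeasureTheory Real
open scoped ENNReal

noncomputable section

abbrev E3 : Type := EuclideanSpace ℝ (Fin 3)

/-- Uniform surface measure on the sphere of radius `r` in `ℝ³` (total mass `4 π r ^ 2`). -/
def sphereSurface (r : ℝ) : Measure E3 :=
  ENNReal.ofReal (r ^ 2) •
    Measure.map (fun x : Metric.sphere (0 : E3) 1 => r • (x : E3))
      ((volume : Measure E3).toSphere)

/-- Fundamental solution of the 3d wave equation: `G r = (4 π r)⁻¹ σ_r`, where `σ_r` is the
uniform surface measure on the sphere of radius `r`. -/
def waveG (r : ℝ) : Measure E3 := (ENNReal.ofReal (4 * π * r))⁻¹ • sphereSurface r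

/-- Integration in polar coordinates on `ℝ³`. -/
lemma integral_polar {f : E3 → ℂ} (hf : Integrable f) :
    ∫ z, f z = ∫ r in Set.Ioi (0 : ℝ), ((r ^ 2 : ℝ) : ℂ) *
      ∫ u, f (r • (u : E3)) ∂((volume : Measure E3).toSphere) := by
  have hmp := (volume : Measure E3).measurePreserving_homeomorphUnitSphereProd
  have hemb := (homeomorphUnitSphereProd E3).measurableEmbedding
  have hd : Module.finrank ℝ E3 - 1 = 2 := by simp
  rw [hd] at hmp
  let g : Metric.sphere (0 : E3) 1 × Set.Ioi (0 : ℝ) → ℂ := fun p => f ((p.2 : ℝ) • (p.1 : E3))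
  have hg : ∀ z : ({(0)}ᶜ : Set E3), g (homeomorphUnitSphereProd E3 z) = f z := by
    intro z
    have hz : ‖(z : E3)‖ ≠ 0 := norm_ne_zero_iff.2 z.2
    simp [g, smul_smul, hz]
  have hint : Integrable g ((volume : Measure E3).toSphere.prod (Measure.volumeIoiPow 2)) := by
    rw [← hmp.integrable_comp_emb hemb]
    have : g ∘ homeomorphUnitSphereProd E3 = f ∘ Subtype.val := funext hg
    rw [this, ← integrableOn_iff_comap_subtypeVal (measurableSet_singleton _).compl]
    exact hf.integrableOn
  calc
    ∫ z, f z = ∫ z : ({(0)}ᶜ : Set E3), f z ∂((volume : Measure E3).comap (↑)) := by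
      rw [integral_subtype_comap (measurableSet_singleton _).compl f,
        restrict_compl_singleton]
    _ = ∫ p, g p ∂((volume : Measure E3).toSphere.prod (Measure.volumeIoiPow 2)) := by
      rw [← hmp.integral_comp hemb]
      exact integral_congr_ae (.of_forall fun z => (hg z).symm)
    _ = ∫ r : Set.Ioi (0 : ℝ), ∫ u, f ((r : ℝ) • (u : E3)) ∂((volume : Measure E3).toSphere)
          ∂(Measure.volumeIoiPow 2) := by
      rw [integral_prod_symm _ hint]
    _ = _ := by
      simp only [Measure.volumeIoiPow, ENNReal.ofReal]
      rw [integral_withDensity_eq_integral_smul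
        (measurable_subtype_coe.pow_const _).real_toNNReal,
        integral_subtype_comap measurableSet_Ioi fun a ↦ Real.toNNReal (a ^ 2) •
          ∫ u, f (a • (u : E3)) ∂((volume : Measure E3).toSphere),
        setIntegral_congr_fun measurableSet_Ioi fun x hx ↦ ?_]
      rw [NNReal.smul_def, Real.coe_toNNReal _ (sq_nonneg x), Complex.real_smul]

/-- The surface measure of the unit sphere, as a measure on the ambient space. -/
def unitSphereMeasure : Measure E3 := ((volume : Measure E3).toSphere).map Subtype.val

instance : IsFiniteMeasure unitSphereMeasure := by
  unfold unitSphereMeasure; infer_instance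

lemma charFun_unitSphereMeasure_smul (r : ℝ) (ξ : E3) :
    charFun unitSphereMeasure (r • ξ) =
      ∫ u, Complex.exp (inner ℝ (r • (u : E3)) ξ * Complex.I)
        ∂((volume : Measure E3).toSphere) := by
  rw [charFun_apply, unitSphereMeasure,
    (MeasurableEmbedding.subtype_coe Metric.isClosed_sphere.measurableSet).integral_map]
  simp [inner_smul_left, inner_smul_right]

/-- Fourier transform of a radial function on `ℝ³`. -/
lemma integral_radial_mul_exp {w : ℝ → ℝ} (hw : Integrable fun z : E3 => w ‖z‖) (ξ : E3) :
    ∫ z : E3, (w ‖z‖ : ℂ) * Complex.exp (inner ℝ z ξ * Complex.I) =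
      ∫ r in Set.Ioi (0 : ℝ), ((r ^ 2 * w r : ℝ) : ℂ) * charFun unitSphereMeasure (r • ξ) := by
  rw [integral_polar]
  · refine setIntegral_congr_fun measurableSet_Ioi fun r (hr : 0 < r) => ?_
    have hu : ∀ u : Metric.sphere (0 : E3) 1, ‖r • (u : E3)‖ = r := fun u => by
      simp [norm_smul, hr.le]
    simp only [hu]
    rw [charFun_unitSphereMeasure_smul, integral_const_mul]
    push_cast
    ring
  · refine hw.ofReal.mul_bdd (c := 1) (by fun_prop) (.of_forall fun z => ?_)
    rw [Complex.norm_exp_ofReal_mul_I]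

/-- A measure-preserving splitting `ℝ × ℝ² ≃ ℝ³` along the first coordinate axis. -/
lemma measurePreserving_euclidean_succ :
    ∃ T : ℝ × EuclideanSpace ℝ (Fin 2) ≃ᵐ E3, MeasurePreserving T ∧
      (∀ p, ‖T p‖ ^ 2 = p.1 ^ 2 + ‖p.2‖ ^ 2) ∧ ∀ p, (T p) 0 = p.1 := by
  let e : ℝ × EuclideanSpace ℝ (Fin 2) ≃ᵐ E3 :=
    ((MeasurableEquiv.refl ℝ).prodCongr (MeasurableEquiv.toLp 2 (Fin 2 → ℝ)).symm).trans
      ((MeasurableEquiv.piFinSuccAbove (fun _ : Fin 3 => ℝ) 0).symm.trans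
        (MeasurableEquiv.toLp 2 (Fin 3 → ℝ)))
  refine ⟨e, ?_, ?_, ?_⟩
  · refine (PiLp.volume_preserving_toLp (Fin 3)).comp
      (((volume_preserving_piFinSuccAbove (fun _ : Fin 3 => ℝ) 0).symm _).comp ?_)
    exact (MeasurePreserving.id _).prod (PiLp.volume_preserving_ofLp (Fin 2))
  · intro p
    rw [EuclideanSpace.real_norm_sq_eq, EuclideanSpace.real_norm_sq_eq, Fin.sum_univ_succ]
    rfl
  · intro p
    rfl

/-- The integral of a plane wave over a ball, for a wave vector along the first axis. -/
lemma setIntegral_ball_exp_axis {R k : ℝ} (hR : 0 < R) (hk : k ≠ 0) :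
    ∫ x in Metric.ball (0 : E3) R, Complex.exp ((k * x 0 : ℝ) * Complex.I) =
      ((4 * π * (sin (k * R) - k * R * cos (k * R)) / k ^ 3 : ℝ) : ℂ) := by
  obtain ⟨T, hT, hnorm, hcoord⟩ := measurePreserving_euclidean_succ
  have hmem : ∀ p, T p ∈ Metric.ball (0 : E3) R ↔
      p.2 ∈ Metric.ball (0 : EuclideanSpace ℝ (Fin 2)) (√(R ^ 2 - p.1 ^ 2)) := by
    intro p
    rw [mem_ball_zero_iff, mem_ball_zero_iff, Real.lt_sqrt (norm_nonneg _),
      ← sq_lt_sq₀ (norm_nonneg _) hR.le, hnorm, lt_sub_iff_add_lt']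
  have hslice : ∀ a : ℝ, ∫ y : EuclideanSpace ℝ (Fin 2),
      (Metric.ball (0 : E3) R).indicator
        (fun x => Complex.exp ((k * x 0 : ℝ) * Complex.I)) (T (a, y)) =
      (Set.Ioc (-R) R).indicator
        (fun a : ℝ => ((π * (R ^ 2 - a ^ 2) : ℝ) : ℂ) * Complex.exp (k * Complex.I * a)) a := by
    intro a
    have h1 : ∀ y : EuclideanSpace ℝ (Fin 2), (Metric.ball (0 : E3) R).indicator
        (fun x => Complex.exp ((k * x 0 : ℝ) * Complex.I)) (T (a, y)) =
        (Metric.ball (0 : EuclideanSpace ℝ (Fin 2)) (√(R ^ 2 - a ^ 2))).indicator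
          (fun _ => Complex.exp (k * Complex.I * a)) y := by
      intro y
      by_cases hy : T (a, y) ∈ Metric.ball (0 : E3) R
      · rw [Set.indicator_of_mem hy, Set.indicator_of_mem ((hmem _).1 hy), hcoord]
        push_cast
        ring_nf
      · rw [Set.indicator_of_notMem hy, Set.indicator_of_notMem (fun h => hy ((hmem _).2 h))]
    simp_rw [h1]
    rw [integral_indicator_const _ Metric.isOpen_ball.measurableSet, Measure.real,
      EuclideanSpace.volume_ball_fin_two]
    by_cases ha : a ∈ Set.Ioc (-R) R
    · have h2 : 0 ≤ R ^ 2 - a ^ 2 := by nlinarith [ha.1, ha.2]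
      rw [Set.indicator_of_mem ha, ← ENNReal.ofReal_pow (sqrt_nonneg _), sq_sqrt h2,
        Complex.real_smul]
      simp [ENNReal.toReal_ofReal h2, mul_comm, pi_pos.le]
    · have h2 : R ^ 2 - a ^ 2 ≤ 0 := by
        rw [sub_nonpos]
        refine sq_le_sq' ?_ ?_ |>.trans_eq (sq_abs a)
        · linarith [abs_nonneg a]
        · rw [Set.mem_Ioc, not_and_or] at ha
          rcases ha with ha | ha
          · exact (by linarith : R ≤ -a).trans (neg_le_abs a)
          · exact (by linarith : R ≤ a).trans (le_abs_self a)
      rw [Set.indicator_of_notMem ha, sqrt_eq_zero_of_nonpos h2]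
      simp
  have hint : Integrable ((Metric.ball (0 : E3) R).indicator
      fun x : E3 => Complex.exp ((k * x 0 : ℝ) * Complex.I)) := by
    rw [integrable_indicator_iff Metric.isOpen_ball.measurableSet]
    have hc : Continuous fun x : E3 => Complex.exp ((k * x 0 : ℝ) * Complex.I) := by fun_prop
    exact (hc.continuousOn.integrableOn_compact
      (isCompact_closedBall (0 : E3) R)).mono_set Metric.ball_subset_closedBall
  have hkC : (k : ℂ) ≠ 0 := by exact_mod_cast hk
  rw [← integral_indicator Metric.isOpen_ball.measurableSet,
    ← hT.integral_comp T.measurableEmbedding]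
  refine (integral_prod _ ((hT.integrable_comp_emb T.measurableEmbedding).2 hint)).trans ?_
  simp only [Function.comp_apply]
  simp_rw [hslice]
  rw [integral_indicator measurableSet_Ioc, ← intervalIntegral.integral_of_le (by linarith)]
  have hderiv : ∀ a ∈ Set.uIcc (-R) R, HasDerivAt
      (fun a : ℝ => (π : ℂ) * (((R : ℂ) ^ 2 - a ^ 2) / (k * Complex.I)
        + 2 * a / (k * Complex.I) ^ 2 - 2 / (k * Complex.I) ^ 3) *
          Complex.exp (k * Complex.I * a))
      (((π * (R ^ 2 - a ^ 2) : ℝ) : ℂ) * Complex.exp (k * Complex.I * a)) a := by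
    intro a _
    have hl : (k : ℂ) * Complex.I ≠ 0 := mul_ne_zero hkC Complex.I_ne_zero
    generalize (k : ℂ) * Complex.I = l at hl
    have ha : HasDerivAt (fun a : ℝ => (a : ℂ)) 1 a := Complex.ofRealCLM.hasDerivAt
    have := (((((ha.pow 2).const_sub ((R : ℂ) ^ 2)).div_const l).add
      ((ha.const_mul 2).div_const (l ^ 2))).sub_const (2 / l ^ 3) |>.const_mul (π : ℂ)).mul
      (ha.const_mul l).cexp
    refine this.congr_deriv ?_
    simp only [Pi.add_apply, Pi.pow_apply]
    push_cast
    field_simp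
    ring
  rw [intervalIntegral.integral_eq_sub_of_hasDerivAt hderiv
    (Continuous.intervalIntegrable (by fun_prop) _ _)]
  have e1 : Complex.exp (k * Complex.I * (R : ℝ)) =
      Complex.cos (k * R) + Complex.sin (k * R) * Complex.I := by
    rw [← Complex.exp_mul_I]; ring_nf
  have e2 : Complex.exp (k * Complex.I * ((-R : ℝ) : ℂ)) =
      Complex.cos (k * R) - Complex.sin (k * R) * Complex.I := by
    rw [← Complex.cos_neg, ← neg_neg (Complex.sin _), ← Complex.sin_neg, neg_mul, sub_neg_eq_add,
      ← Complex.exp_mul_I]; push_cast; ring_nf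
  rw [e1, e2]
  have hI3 : Complex.I ^ 3 = -Complex.I := by rw [pow_succ, Complex.I_sq]; ring
  push_cast
  simp only [mul_pow, Complex.I_sq, hI3]
  field_simp
  ring_nf

/-- The integral of a plane wave over a ball. -/
lemma setIntegral_ball_exp {R : ℝ} (hR : 0 < R) {ξ : E3} (hξ : ξ ≠ 0) :
    ∫ x in Metric.ball (0 : E3) R, Complex.exp (inner ℝ x ξ * Complex.I) =
      ((4 * π * (sin (‖ξ‖ * R) - ‖ξ‖ * R * cos (‖ξ‖ * R)) / ‖ξ‖ ^ 3 : ℝ) : ℂ) := by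
  rw [← setIntegral_ball_exp_axis hR (norm_ne_zero_iff.2 hξ)]
  let η : E3 := EuclideanSpace.single 0 ‖ξ‖
  have hη : ‖η‖ = ‖ξ‖ := by simp [η]
  let L := (ℝ ∙ (η - ξ))ᗮ.reflection
  have hL : L η = ξ := Submodule.reflection_sub hη
  have hpre : L ⁻¹' Metric.ball (0 : E3) R = Metric.ball 0 R := by
    ext x; simp
  have hmp : MeasurePreserving L := L.measurePreserving
  rw [← hmp.setIntegral_preimage_emb L.toHomeomorph.measurableEmbedding, hpre]
  have : ∀ x : E3, inner ℝ (L x) ξ = ‖ξ‖ * x 0 := by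
    intro x
    rw [← hL, L.inner_map_map, hL]
    simp [η, EuclideanSpace.inner_single_right]
  simp_rw [this]

/-- Fourier transform of the surface measure of the unit sphere. -/
lemma charFun_unitSphereMeasure {ξ : E3} (hξ : ξ ≠ 0) :
    charFun unitSphereMeasure ξ = ((4 * π * sin ‖ξ‖ / ‖ξ‖ : ℝ) : ℂ) := by
  have hk : ‖ξ‖ ≠ 0 := norm_ne_zero_iff.2 hξ
  have hcont : Continuous fun r : ℝ =>
      ((r ^ 2 : ℝ) : ℂ) * charFun unitSphereMeasure (r • ξ) := by
    have := continuous_charFun (μ := unitSphereMeasure)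
    fun_prop
  have hball : ∀ R : ℝ, 0 < R →
      ∫ r in (0 : ℝ)..R, ((r ^ 2 : ℝ) : ℂ) * charFun unitSphereMeasure (r • ξ) =
      ((4 * π * (sin (‖ξ‖ * R) - ‖ξ‖ * R * cos (‖ξ‖ * R)) / ‖ξ‖ ^ 3 : ℝ) : ℂ) := by
    intro R hR
    rw [← setIntegral_ball_exp hR hξ, ← integral_indicator Metric.isOpen_ball.measurableSet]
    have hw : Integrable fun z : E3 => (Set.Iio R).indicator (fun _ => (1 : ℝ)) ‖z‖ := by
      have : (fun z : E3 => (Set.Iio R).indicator (fun _ => (1 : ℝ)) ‖z‖) =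
          (Metric.ball (0 : E3) R).indicator fun _ => 1 := by
        ext z; simp [Set.indicator]
      rw [this, integrable_indicator_iff Metric.isOpen_ball.measurableSet]
      exact integrableOn_const Metric.isBounded_ball.measure_lt_top.ne
    have h1 := integral_radial_mul_exp hw ξ
    have h2 : ∀ z : E3, (Metric.ball (0 : E3) R).indicator
        (fun x => Complex.exp (inner ℝ x ξ * Complex.I)) z =
        (((Set.Iio R).indicator (fun _ => (1 : ℝ)) ‖z‖ : ℝ) : ℂ) *
          Complex.exp (inner ℝ z ξ * Complex.I) := by
      intro z
      by_cases hz : ‖z‖ < R <;> simp [Set.indicator, hz]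
    simp_rw [h2]
    rw [h1, intervalIntegral.integral_of_le hR.le, integral_Ioc_eq_integral_Ioo,
      ← integral_indicator measurableSet_Ioo, ← integral_indicator measurableSet_Ioi]
    refine integral_congr_ae (.of_forall fun r => ?_)
    by_cases h0 : 0 < r <;> by_cases hr : r < R <;> simp [Set.indicator, h0, hr]
  have hd1 := intervalIntegral.integral_hasDerivAt_right (hcont.intervalIntegrable 0 1)
    (hcont.stronglyMeasurableAtFilter _ _) hcont.continuousAt
  have hd2 : HasDerivAt (fun R : ℝ =>
      ((4 * π * (sin (‖ξ‖ * R) - ‖ξ‖ * R * cos (‖ξ‖ * R)) / ‖ξ‖ ^ 3 : ℝ) : ℂ))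
      ((4 * π * sin ‖ξ‖ / ‖ξ‖ : ℝ) : ℂ) 1 := by
    refine HasDerivAt.ofReal_comp ?_
    have hm : HasDerivAt (fun R : ℝ => ‖ξ‖ * R) ‖ξ‖ 1 := by
      simpa using (hasDerivAt_id (1 : ℝ)).const_mul ‖ξ‖
    refine (((hm.sin.sub (hm.mul hm.cos)).const_mul (4 * π)).div_const (‖ξ‖ ^ 3)).congr_deriv ?_
    simp only [mul_one]
    field_simp
    ring
  have hd3 := hd2.congr_of_eventuallyEq (f₁ := fun R : ℝ =>
    ∫ r in (0 : ℝ)..R, ((r ^ 2 : ℝ) : ℂ) * charFun unitSphereMeasure (r • ξ))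
    ((eventually_gt_nhds one_pos).mono hball)
  simpa using hd1.unique hd3

lemma waveG_eq {r : ℝ} (hr : 0 < r) :
    waveG r = ENNReal.ofReal (r / (4 * π)) • unitSphereMeasure.map (r • ·) := by
  have h4 : 0 < 4 * π * r := by positivity
  rw [waveG, sphereSurface, smul_smul, ← ENNReal.ofReal_inv_of_pos h4,
    ← ENNReal.ofReal_mul (by positivity), unitSphereMeasure,
    Measure.map_map (by fun_prop) (by fun_prop)]
  congr 2
  field_simp

lemma isFiniteMeasure_waveG {r : ℝ} (hr : 0 < r) : IsFiniteMeasure (waveG r) := by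
  rw [waveG_eq hr]
  exact Measure.smul_finite _ ENNReal.ofReal_ne_top

/-- The Fourier transform of the fundamental solution of the wave equation. -/
lemma charFun_waveG {r : ℝ} (hr : 0 < r) {ξ : E3} (hξ : ξ ≠ 0) :
    charFun (waveG r) ξ = ((sin (r * ‖ξ‖) / ‖ξ‖ : ℝ) : ℂ) := by
  have hk : ‖ξ‖ ≠ 0 := norm_ne_zero_iff.2 hξ
  rw [waveG_eq hr, charFun_apply, integral_smul_measure, ← charFun_apply, charFun_map_smul,
    charFun_unitSphereMeasure (smul_ne_zero hr.ne' hξ), ENNReal.toReal_ofReal (by positivity),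
    norm_smul, norm_of_nonneg hr.le, Complex.real_smul, ← Complex.ofReal_mul]
  congr 1
  field_simp

/-- The radial profile of the density of `waveG s ∗ waveG t`. -/
def convProfile (s t r : ℝ) : ℝ :=
  if s - t ≤ r ∧ r ≤ s + t then (8 * π * r)⁻¹ else 0

lemma measurable_ofReal_convProfile_norm (s t : ℝ) :
    Measurable fun z : E3 => ENNReal.ofReal (convProfile s t ‖z‖) := by
  have h : Measurable (convProfile s t) :=
    Measurable.ite (measurableSet_Icc (a := s - t) (b := s + t)) (by fun_prop) measurable_const
  exact (h.comp measurable_norm).ennreal_ofReal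

lemma convProfile_nonneg {s t r : ℝ} (hr : 0 ≤ r) : 0 ≤ convProfile s t r := by
  unfold convProfile
  split_ifs <;> positivity

lemma integrable_convProfile_norm (s t : ℝ) : Integrable fun z : E3 => convProfile s t ‖z‖ := by
  rw [integrable_fun_norm_addHaar]
  have h : IntegrableOn ((Set.Icc (s - t) (s + t)).indicator fun r : ℝ => r / (8 * π))
      (Set.Ioi 0) := by
    refine Integrable.integrableOn ?_
    rw [integrable_indicator_iff measurableSet_Icc]
    exact ContinuousOn.integrableOn_Icc (by fun_prop)
  refine h.congr_fun (fun r (hr : 0 < r) => ?_) measurableSet_Ioi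
  by_cases hm : s - t ≤ r ∧ r ≤ s + t
  · simp only [convProfile, Set.indicator, Set.mem_Icc, hm, if_true, and_self]
    simp
    field_simp
  · simp only [convProfile, Set.indicator, Set.mem_Icc, hm, if_false, smul_zero]

lemma integral_convProfile_mul_exp {s t : ℝ} (ht : 0 < t) (hst : t ≤ s) {ξ : E3} (hξ : ξ ≠ 0) :
    ∫ z : E3, (convProfile s t ‖z‖ : ℂ) * Complex.exp (inner ℝ z ξ * Complex.I) =
      ((sin (s * ‖ξ‖) / ‖ξ‖ * (sin (t * ‖ξ‖) / ‖ξ‖) : ℝ) : ℂ) := by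
  have hk : ‖ξ‖ ≠ 0 := norm_ne_zero_iff.2 hξ
  rw [integral_radial_mul_exp (integrable_convProfile_norm s t)]
  have h1 : ∀ r ∈ Set.Ioi (0 : ℝ),
      ((r ^ 2 * convProfile s t r : ℝ) : ℂ) * charFun unitSphereMeasure (r • ξ) =
      (((Set.Icc (s - t) (s + t)).indicator (fun r => sin (‖ξ‖ * r) / (2 * ‖ξ‖)) r : ℝ) : ℂ) := by
    intro r (hr : 0 < r)
    rw [charFun_unitSphereMeasure (smul_ne_zero hr.ne' hξ), norm_smul, norm_of_nonneg hr.le,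
      ← Complex.ofReal_mul]
    congr 1
    by_cases hm : s - t ≤ r ∧ r ≤ s + t
    · simp only [convProfile, Set.indicator, Set.mem_Icc, hm, if_true, and_self]
      rw [mul_comm ‖ξ‖ r]
      field_simp
      ring
    · simp only [convProfile, Set.indicator, Set.mem_Icc, hm, if_false, mul_zero, zero_mul]
  rw [setIntegral_congr_fun measurableSet_Ioi h1, integral_complex_ofReal]
  congr 1
  have h2 : Set.Ioi (0 : ℝ) ∩ Set.Ioc (s - t) (s + t) = Set.Ioc (s - t) (s + t) :=
    Set.inter_eq_right.2 fun r hr => (sub_nonneg.2 hst).trans_lt hr.1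
  rw [integral_congr_ae (ae_restrict_of_ae (indicator_ae_eq_of_ae_eq_set Ioc_ae_eq_Icc.symm)),
    setIntegral_indicator measurableSet_Ioc, h2,
    ← intervalIntegral.integral_of_le (by linarith)]
  have hderiv : ∀ r ∈ Set.uIcc (s - t) (s + t),
      HasDerivAt (fun r => -cos (‖ξ‖ * r) / (2 * ‖ξ‖ ^ 2)) (sin (‖ξ‖ * r) / (2 * ‖ξ‖)) r := by
    intro r _
    have hm : HasDerivAt (fun r : ℝ => ‖ξ‖ * r) ‖ξ‖ r := by
      simpa using (hasDerivAt_id r).const_mul ‖ξ‖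
    refine (hm.cos.neg.div_const (2 * ‖ξ‖ ^ 2)).congr_deriv ?_
    field_simp
  rw [intervalIntegral.integral_eq_sub_of_hasDerivAt hderiv
    (Continuous.intervalIntegrable (by fun_prop) _ _), mul_add, mul_sub, cos_add, cos_sub,
    mul_comm ‖ξ‖ s, mul_comm ‖ξ‖ t]
  field_simp
  ring

/-- The convolution of two fundamental solutions has an explicit radial density. -/
lemma waveG_conv_waveG {s t : ℝ} (ht : 0 < t) (hst : t ≤ s) :
    (waveG s).conv (waveG t) =
      (volume : Measure E3).withDensity fun z => ENNReal.ofReal (convProfile s t ‖z‖) := by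
  have := isFiniteMeasure_waveG ht
  have := isFiniteMeasure_waveG (ht.trans_le hst)
  have : IsFiniteMeasure ((volume : Measure E3).withDensity
      fun z => ENNReal.ofReal (convProfile s t ‖z‖)) :=
    isFiniteMeasure_withDensity_ofReal (integrable_convProfile_norm s t).hasFiniteIntegral
  refine Measure.ext_of_charFun (Continuous.ext_on (dense_compl_singleton (0 : E3))
    continuous_charFun continuous_charFun fun ξ (hξ : ξ ≠ 0) => ?_)
  rw [charFun_conv, charFun_waveG (ht.trans_le hst) hξ, charFun_waveG ht hξ, charFun_apply,
    ← Complex.ofReal_mul, ← integral_convProfile_mul_exp ht hst hξ,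
    integral_withDensity_eq_integral_toReal_smul
      (measurable_ofReal_convProfile_norm s t)
      (.of_forall fun _ => ENNReal.ofReal_lt_top)]
  refine integral_congr_ae (.of_forall fun z => ?_)
  simp only
  rw [ENNReal.toReal_ofReal (convProfile_nonneg (norm_nonneg z)), Complex.real_smul]

/-- Lemma 7.1: for `s ≥ t > 0`, the convolution `G(s) * G(t)` has density
`(8 π |x|)⁻¹ 𝟙_{[s-t, s+t]}(|x|)` with respect to Lebesgue measure. -/
theorem conv_of_G_G (s t : ℝ) (ht : 0 < t) (hst : t ≤ s)
    (φ : E3 → ℝ≥0∞) (hφ : Measurable φ) :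
    ∫⁻ x, (∫⁻ y, φ (x + y) ∂(waveG t)) ∂(waveG s)
      = ∫⁻ z, φ z *
          ENNReal.ofReal (if s - t ≤ ‖z‖ ∧ ‖z‖ ≤ s + t then (8 * π * ‖z‖)⁻¹ else 0) := by
  have := isFiniteMeasure_waveG ht
  rw [← Measure.lintegral_conv hφ, waveG_conv_waveG ht hst,
    lintegral_withDensity_eq_lintegral_mul _
      (measurable_ofReal_convProfile_norm s t) hφ]
  exact lintegral_congr fun z => mul_comm _ _
end
end

section
/- Let 0 < β < 2, T > 0, f(x) = |x|^{−β} for x ∈ ℝ³\{0}, and let 0 < ρ₁ < min(2−β, 1). Then there exists a constant C > 0 such that for all 0 < h ≤ 1, ∫₀^T ∫_{S²} ∫_{S²} |f(s(ξ+η) + h(ξ+η)) − f(s(ξ+η) + hη)| s σ(dξ) σ(dη) ds ≤ C h^{ρ₁}. -/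
open MeasureTheory Real
open scoped ENNReal

noncomputable section

/-- Uniform surface measure on the unit sphere `S²` in `ℝ³` (total mass `4 π`),
viewed as a measure on `ℝ³`. -/
def sphereMeasure : Measure E3 :=
  Measure.map (fun x : Metric.sphere (0 : E3) 1 => (x : E3)) ((volume : Measure E3).toSphere)

/-- If `a, b ≥ m > 0` differ by at most `h`, then `|a^{-β} - b^{-β}| ≤ 2 h^ρ m^{-(β+ρ)}`
for `0 ≤ β ≤ 2` and `0 ≤ ρ ≤ 1`. -/
theorem abs_rpow_neg_sub_rpow_neg_le {a b m h β ρ : ℝ} (hm : 0 < m) (ha : m ≤ a) (hb : m ≤ b)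
    (hh : 0 < h) (hab : |a - b| ≤ h) (hβ0 : 0 ≤ β) (hβ2 : β ≤ 2) (hρ0 : 0 ≤ ρ) (hρ1 : ρ ≤ 1) :
    |a ^ (-β) - b ^ (-β)| ≤ 2 * h ^ ρ * m ^ (-(β + ρ)) := by
  wlog hle : a ≤ b generalizing a b
  · rw [abs_sub_comm]
    exact this hb ha (by rwa [abs_sub_comm]) (le_of_not_ge hle)
  have ha0 : 0 < a := hm.trans_le ha
  have hb0 : 0 < b := hm.trans_le hb
  set t := a / b with ht
  have ht0 : 0 < t := div_pos ha0 hb0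
  have ht1 : t ≤ 1 := (div_le_one hb0).2 hle
  have hbt : b ^ (-β) = a ^ (-β) * t ^ β := by
    rw [ht, Real.div_rpow ha0.le hb0.le, Real.rpow_neg ha0.le, Real.rpow_neg hb0.le]
    have := (Real.rpow_pos_of_pos ha0 β).ne'
    field_simp
  have htβ : t ^ (2 : ℝ) ≤ t ^ β := Real.rpow_le_rpow_of_exponent_ge ht0 ht1 hβ2
  rw [Real.rpow_two] at htβ
  have htβ1 : t ^ β ≤ 1 := Real.rpow_le_one ht0.le ht1 hβ0
  have h1t : 1 - t ≤ h / m := by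
    have hbh : b - a ≤ h := by rw [abs_sub_comm] at hab; exact (le_abs_self _).trans hab
    calc 1 - t = (b - a) / b := by rw [ht]; field_simp
      _ ≤ h / m := by gcongr
  have hpow : 1 - t ≤ (h / m) ^ ρ :=
    calc 1 - t = (1 - t) ^ (1 : ℝ) := (Real.rpow_one _).symm
      _ ≤ (1 - t) ^ ρ :=
        Real.rpow_le_rpow_of_exponent_ge_of_imp (by linarith) (by linarith) hρ1
          (fun _ h1 ↦ absurd h1 one_ne_zero)
      _ ≤ (h / m) ^ ρ := Real.rpow_le_rpow (by linarith) h1t hρ0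
  have hkey : 1 - t ^ β ≤ 2 * (h / m) ^ ρ := by nlinarith
  have ham : a ^ (-β) ≤ m ^ (-β) := Real.rpow_le_rpow_of_nonpos hm ha (by linarith)
  rw [hbt, ← mul_one_sub, abs_of_nonneg (mul_nonneg (by positivity) (by linarith))]
  calc a ^ (-β) * (1 - t ^ β) ≤ m ^ (-β) * (2 * (h / m) ^ ρ) :=
        mul_le_mul ham hkey (by linarith) (by positivity)
    _ = 2 * h ^ ρ * m ^ (-(β + ρ)) := by
        rw [Real.div_rpow hh.le hm.le, Real.rpow_neg hm.le, Real.rpow_neg hm.le,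
          Real.rpow_add hm]
        field_simp

/-- For unit vectors, `‖s(ξ+η) + hη‖² = h² + s(s+h)‖ξ+η‖²`, hence `s‖ξ+η‖` is a lower bound. -/
theorem mul_norm_add_le_norm_smul_add_smul {E : Type*} [NormedAddCommGroup E]
    [InnerProductSpace ℝ E] {ξ η : E} (hξ : ‖ξ‖ = 1) (hη : ‖η‖ = 1) {s h : ℝ}
    (hs : 0 ≤ s) (hh : 0 ≤ h) : s * ‖ξ + η‖ ≤ ‖s • (ξ + η) + h • η‖ := by
  refine le_of_sq_le_sq ?_ (norm_nonneg _)
  have h1 : ‖ξ + η‖ ^ 2 = 2 + 2 * inner ℝ ξ η := by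
    rw [norm_add_sq_real, hξ, hη]; ring
  have h2 : ‖s • (ξ + η) + h • η‖ ^ 2 = h ^ 2 + s * (s + h) * ‖ξ + η‖ ^ 2 := by
    rw [norm_add_sq_real, norm_smul, norm_smul, real_inner_smul_left, real_inner_smul_right,
      inner_add_left, real_inner_self_eq_norm_sq, hη, mul_pow, h1, Real.norm_eq_abs,
      Real.norm_eq_abs, mul_one, sq_abs, sq_abs]
    ring
  rw [h2, mul_pow]
  nlinarith [mul_nonneg (mul_nonneg hs hh) (sq_nonneg ‖ξ + η‖), sq_nonneg h]

theorem measurable_sphere_coe :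
    Measurable (fun x : Metric.sphere (0 : E3) 1 => (x : E3)) := measurable_subtype_coe

instance : IsFiniteMeasure sphereMeasure := by
  unfold sphereMeasure; infer_instance

theorem ae_sphereMeasure_norm_eq_one : ∀ᵐ ξ ∂sphereMeasure, ‖ξ‖ = 1 := by
  unfold sphereMeasure
  rw [ae_map_iff measurable_sphere_coe.aemeasurable
    (measurableSet_eq_fun measurable_norm measurable_const)]
  exact Filter.Eventually.of_forall fun x ↦ by simp

open scoped Pointwise in
/-- A spherical cap of radius `2 / N` has surface measure `O(1 / N²)`. -/
theorem sphereMeasure_closedBall_le {ξ : E3} (hξ : ‖ξ‖ = 1) {N : ℕ} (hN : 0 < N) :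
    sphereMeasure (Metric.closedBall ξ (2 / N)) ≤
      ENNReal.ofReal (81 / (N : ℝ) ^ 2) * volume (Metric.ball (0 : E3) 1) := by
  have hN' : (0 : ℝ) < N := by exact_mod_cast hN
  have hcone : Set.Ioo (0 : ℝ) 1 • ((fun x : Metric.sphere (0 : E3) 1 => (x : E3)) ''
      ((fun x : Metric.sphere (0 : E3) 1 => (x : E3)) ⁻¹' Metric.closedBall ξ (2 / N))) ⊆
      ⋃ k ∈ Finset.range N, Metric.closedBall (((k : ℝ) / N) • ξ) (3 / N) := by
    rintro _ ⟨c, ⟨hc0, hc1⟩, _, ⟨x, hx, rfl⟩, rfl⟩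
    have hcN : 0 ≤ c * N := by positivity
    have hfl := Nat.floor_le hcN
    have hlt := Nat.lt_floor_add_one (c * N)
    simp only [Set.mem_iUnion, Finset.mem_range]
    refine ⟨⌊c * N⌋₊, (Nat.floor_lt hcN).2 (by nlinarith), ?_⟩
    rw [Set.mem_preimage, Metric.mem_closedBall, dist_eq_norm] at hx
    rw [Metric.mem_closedBall, dist_eq_norm]
    have hsplit : c • (x : E3) - ((⌊c * N⌋₊ : ℝ) / N) • ξ =
        c • ((x : E3) - ξ) + (c - (⌊c * N⌋₊ : ℝ) / N) • ξ := by module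
    have hcoef : |c - (⌊c * N⌋₊ : ℝ) / N| ≤ 1 / N := by
      rw [abs_le, neg_le, neg_sub, sub_le_iff_le_add, sub_le_iff_le_add]
      constructor
      · rw [div_le_iff₀ hN', add_mul, one_div_mul_cancel hN'.ne']; linarith
      · rw [← add_div, le_div_iff₀ hN']; linarith
    calc ‖c • (x : E3) - ((⌊c * N⌋₊ : ℝ) / N) • ξ‖
        ≤ ‖c • ((x : E3) - ξ)‖ + ‖(c - (⌊c * N⌋₊ : ℝ) / N) • ξ‖ := by
          rw [hsplit]; exact norm_add_le _ _
      _ = c * ‖(x : E3) - ξ‖ + |c - (⌊c * N⌋₊ : ℝ) / N| := by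
          rw [norm_smul, norm_smul, hξ, mul_one, Real.norm_eq_abs, Real.norm_eq_abs,
            abs_of_pos hc0]
      _ ≤ 1 * (2 / N) + 1 / N := by gcongr
      _ = 3 / N := by ring
  have hball : ∀ k : ℕ, volume (Metric.closedBall (((k : ℝ) / N) • ξ) (3 / N)) =
      ENNReal.ofReal ((3 / (N : ℝ)) ^ 3) * volume (Metric.ball (0 : E3) 1) := fun k ↦ by
    rw [Measure.addHaar_closedBall _ _ (by positivity), finrank_euclideanSpace_fin]
  unfold sphereMeasure
  rw [Measure.map_apply measurable_sphere_coe Metric.isClosed_closedBall.measurableSet,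
    Measure.toSphere_apply' _ (measurable_sphere_coe Metric.isClosed_closedBall.measurableSet),
    finrank_euclideanSpace_fin]
  calc ((3 : ℕ) : ℝ≥0∞) * volume (Set.Ioo (0 : ℝ) 1 •
        ((fun x : Metric.sphere (0 : E3) 1 => (x : E3)) ''
        ((fun x : Metric.sphere (0 : E3) 1 => (x : E3)) ⁻¹' Metric.closedBall ξ (2 / N))))
      ≤ (3 : ℕ) * ∑ k ∈ Finset.range N, volume (Metric.closedBall (((k : ℝ) / N) • ξ) (3 / N)) := by
        gcongr
        exact (measure_mono hcone).trans (measure_biUnion_finset_le _ _)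
    _ = ENNReal.ofReal (81 / (N : ℝ) ^ 2) * volume (Metric.ball (0 : E3) 1) := by
        simp only [hball, Finset.sum_const, Finset.card_range, nsmul_eq_mul]
        rw [← mul_assoc, ← mul_assoc, ← ENNReal.ofReal_natCast, ← ENNReal.ofReal_natCast,
          ← ENNReal.ofReal_mul (by positivity), ← ENNReal.ofReal_mul (by positivity)]
        congr 2
        push_cast
        field_simp
        norm_num

/-- Dyadic decomposition of the singularity `‖ξ + η‖^{-γ}`. -/
theorem ofReal_norm_add_rpow_neg_le_tsum {ξ η : E3} (hξ : ‖ξ‖ = 1) (hη : ‖η‖ = 1) {γ : ℝ}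
    (hγ : 0 < γ) :
    ENNReal.ofReal ‖ξ + η‖ ^ (-γ) ≤ ∑' n : ℕ, (Metric.closedBall (-ξ) (2 / (2 ^ n : ℕ))).indicator
      (fun _ ↦ ENNReal.ofReal ((2 ^ γ) ^ n)) η := by
  have hmem : ∀ n : ℕ, ‖ξ + η‖ ≤ 2 / (2 ^ n : ℕ) →
      η ∈ Metric.closedBall (-ξ) (2 / (2 ^ n : ℕ)) := fun n hn ↦ by
    rwa [Metric.mem_closedBall, dist_eq_norm, sub_neg_eq_add, add_comm]
  rcases (norm_nonneg (ξ + η)).eq_or_lt with h0 | hpos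
  · refine le_top.trans ?_
    rw [← ENNReal.tsum_const_eq_top_of_ne_zero (α := ℕ) one_ne_zero]
    refine ENNReal.tsum_le_tsum fun n ↦ ?_
    rw [Set.indicator_of_mem (hmem n (by rw [← h0]; positivity)), ENNReal.one_le_ofReal]
    exact one_le_pow₀ (Real.one_le_rpow one_le_two hγ.le)
  · have hle : ‖ξ + η‖ ≤ 2 := (norm_add_le _ _).trans (by rw [hξ, hη]; norm_num)
    obtain ⟨n, hn1, hn2⟩ := exists_nat_pow_near_of_lt_one (x := ‖ξ + η‖ / 2) (y := (1 / 2 : ℝ))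
      (by positivity) (by linarith) (by norm_num) (by norm_num)
    have hlow : (2 ^ n : ℝ)⁻¹ ≤ ‖ξ + η‖ := by
      rw [pow_succ, one_div, inv_pow] at hn1; linarith
    have hupp : ‖ξ + η‖ ≤ 2 / (2 ^ n : ℕ) := by
      rw [one_div, inv_pow] at hn2
      push_cast
      rw [div_eq_mul_inv]; linarith
    refine le_trans ?_ (ENNReal.le_tsum n)
    rw [Set.indicator_of_mem (hmem n hupp), ENNReal.ofReal_rpow_of_pos hpos]
    refine ENNReal.ofReal_le_ofReal ?_
    calc ‖ξ + η‖ ^ (-γ) ≤ ((2 ^ n : ℝ)⁻¹) ^ (-γ) :=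
          Real.rpow_le_rpow_of_nonpos (by positivity) hlow (by linarith)
      _ = (2 ^ γ) ^ n := by
          rw [Real.rpow_neg (by positivity), Real.inv_rpow (by positivity), inv_inv,
            ← Real.rpow_natCast_mul two_pos.le, ← Real.rpow_mul_natCast two_pos.le, mul_comm]

/-- The potential of order `γ < 2` of the surface measure is bounded on the sphere. -/
theorem exists_lintegral_norm_add_rpow_neg_le {γ : ℝ} (hγ0 : 0 < γ) (hγ2 : γ < 2) :
    ∃ K : ℝ≥0∞, K ≠ ⊤ ∧ ∀ ξ : E3, ‖ξ‖ = 1 →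
      ∫⁻ η, ENNReal.ofReal ‖ξ + η‖ ^ (-γ) ∂sphereMeasure ≤ K := by
  have hq : (2 : ℝ) ^ γ / 4 < 1 := by
    have := Real.rpow_lt_rpow_of_exponent_lt one_lt_two hγ2
    rw [Real.rpow_two] at this
    linarith
  have hsum : Summable fun n : ℕ ↦ 81 * ((2 : ℝ) ^ γ / 4) ^ n :=
    (summable_geometric_of_lt_one (by positivity) hq).mul_left _
  refine ⟨(∑' n : ℕ, ENNReal.ofReal (81 * ((2 : ℝ) ^ γ / 4) ^ n)) *
    volume (Metric.ball (0 : E3) 1), ENNReal.mul_ne_top hsum.tsum_ofReal_ne_top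
    measure_ball_lt_top.ne, fun ξ hξ ↦ ?_⟩
  calc ∫⁻ η, ENNReal.ofReal ‖ξ + η‖ ^ (-γ) ∂sphereMeasure
      ≤ ∫⁻ η, ∑' n : ℕ, (Metric.closedBall (-ξ) (2 / (2 ^ n : ℕ))).indicator
          (fun _ ↦ ENNReal.ofReal ((2 ^ γ) ^ n)) η ∂sphereMeasure :=
        lintegral_mono_ae <| ae_sphereMeasure_norm_eq_one.mono fun η hη ↦
          ofReal_norm_add_rpow_neg_le_tsum hξ hη hγ0
    _ = ∑' n : ℕ, ENNReal.ofReal ((2 ^ γ) ^ n) *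
          sphereMeasure (Metric.closedBall (-ξ) (2 / (2 ^ n : ℕ))) := by
        rw [lintegral_tsum fun n ↦ (measurable_const.indicator
          Metric.isClosed_closedBall.measurableSet).aemeasurable]
        simp_rw [lintegral_indicator_const Metric.isClosed_closedBall.measurableSet]
    _ ≤ ∑' n : ℕ, ENNReal.ofReal (81 * ((2 : ℝ) ^ γ / 4) ^ n) *
          volume (Metric.ball (0 : E3) 1) := by
        refine ENNReal.tsum_le_tsum fun n ↦ ?_
        refine (mul_le_mul_right (sphereMeasure_closedBall_le (by rwa [norm_neg])
          (pow_pos two_pos n)) _).trans_eq ?_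
        rw [← mul_assoc, ← ENNReal.ofReal_mul (by positivity)]
        congr 2
        push_cast
        rw [div_pow, ← pow_mul, mul_comm n 2, pow_mul]
        norm_num
        ring
    _ = _ := ENNReal.tsum_mul_right

/-- Pointwise bound of the increment of the Riesz kernel, valid with the value `∞` at `ξ = -η`. -/
theorem ofReal_abs_riesz_increment_le {ξ η : E3} (hξ : ‖ξ‖ = 1) (hη : ‖η‖ = 1)
    {β ρ s h : ℝ} (hβ0 : 0 ≤ β) (hβ2 : β ≤ 2) (hρ0 : 0 < ρ) (hρ1 : ρ ≤ 1) (hs : 0 < s)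
    (hh : 0 < h) :
    ENNReal.ofReal
        (|‖s • (ξ + η) + h • (ξ + η)‖ ^ (-β) - ‖s • (ξ + η) + h • η‖ ^ (-β)| * s) ≤
      ENNReal.ofReal (2 * h ^ ρ) * ENNReal.ofReal (s ^ (1 - (β + ρ))) *
        ENNReal.ofReal ‖ξ + η‖ ^ (-(β + ρ)) := by
  have hγ : 0 < β + ρ := by linarith
  rcases (norm_nonneg (ξ + η)).eq_or_lt with h0 | hpos
  · rw [← h0, ENNReal.ofReal_zero, ENNReal.zero_rpow_of_neg (by linarith), ENNReal.mul_top]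
    · exact le_top
    · exact mul_ne_zero (ENNReal.ofReal_pos.2 (by positivity)).ne'
        (ENNReal.ofReal_pos.2 (by positivity)).ne'
  · rw [ENNReal.ofReal_rpow_of_pos hpos, ← ENNReal.ofReal_mul (by positivity),
      ← ENNReal.ofReal_mul (by positivity)]
    refine ENNReal.ofReal_le_ofReal ?_
    have ha : s * ‖ξ + η‖ ≤ ‖s • (ξ + η) + h • (ξ + η)‖ := by
      rw [← add_smul, norm_smul, Real.norm_eq_abs, abs_of_pos (by positivity)]
      gcongr
      linarith
    have hdiff : |‖s • (ξ + η) + h • (ξ + η)‖ - ‖s • (ξ + η) + h • η‖| ≤ h := by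
      refine (abs_norm_sub_norm_le _ _).trans_eq ?_
      rw [show s • (ξ + η) + h • (ξ + η) - (s • (ξ + η) + h • η) = h • ξ by module, norm_smul,
        hξ, mul_one, Real.norm_eq_abs, abs_of_pos hh]
    calc _ ≤ 2 * h ^ ρ * (s * ‖ξ + η‖) ^ (-(β + ρ)) * s := by
          gcongr
          exact abs_rpow_neg_sub_rpow_neg_le (by positivity) ha
            (mul_norm_add_le_norm_smul_add_smul hξ hη hs.le hh.le) hh hdiff hβ0 hβ2 hρ0.le hρ1
      _ = _ := by
          rw [Real.mul_rpow hs.le hpos.le, sub_eq_add_neg, Real.rpow_add hs, Real.rpow_one]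
          ring

theorem lintegral_Ioc_ofReal_rpow_ne_top {p : ℝ} (hp : -1 < p) (T : ℝ) (hT : 0 ≤ T) :
    ∫⁻ s in Set.Ioc (0 : ℝ) T, ENNReal.ofReal (s ^ p) ≠ ⊤ := by
  have h_integrable := (intervalIntegrable_iff_integrableOn_Ioc_of_le hT).1
    (intervalIntegral.intervalIntegrable_rpow' (a := 0) (b := T) hp)
  exact h_integrable.lintegral_lt_top.ne

/-- Proposition 5.2, condition (4.1), for the Riesz kernel `f(x) = |x|^{-β}`, `0 < β < 2`:
for `0 < ρ₁ < min(2-β, 1)` there is `C > 0` such that for all `0 < h ≤ 1`,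
`∫₀^T ∫_{S²} ∫_{S²} |f(s(ξ+η)+h(ξ+η)) - f(s(ξ+η)+hη)| s σ(dξ) σ(dη) ds ≤ C h^{ρ₁}`. -/
theorem riesz_time_condition_one
    (β T ρ₁ : ℝ) (hβ0 : 0 < β) (hβ2 : β < 2) (hT : 0 < T)
    (hρ0 : 0 < ρ₁) (hρ1 : ρ₁ < min (2 - β) 1) :
    ∃ C : ℝ, 0 < C ∧ ∀ h : ℝ, 0 < h → h ≤ 1 →
      (∫⁻ s in Set.Ioc (0 : ℝ) T, ∫⁻ ξ, ∫⁻ η,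
          ENNReal.ofReal
            (|‖s • (ξ + η) + h • (ξ + η)‖ ^ (-β) - ‖s • (ξ + η) + h • η‖ ^ (-β)| * s)
        ∂sphereMeasure ∂sphereMeasure)
      ≤ ENNReal.ofReal (C * h ^ ρ₁) := by
  obtain ⟨hρβ, hρ1'⟩ := lt_min_iff.1 hρ1
  have hγ0 : 0 < β + ρ₁ := by linarith
  obtain ⟨K, hK, hbound⟩ := exists_lintegral_norm_add_rpow_neg_le hγ0 (by linarith)
  set I := ∫⁻ s in Set.Ioc (0 : ℝ) T, ENNReal.ofReal (s ^ (1 - (β + ρ₁))) with hI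
  have hItop : I ≠ ⊤ := lintegral_Ioc_ofReal_rpow_ne_top (by linarith) T hT.le
  set M := I * (K * sphereMeasure Set.univ) with hM
  have hMtop : M ≠ ⊤ :=
    ENNReal.mul_ne_top hItop (ENNReal.mul_ne_top hK (measure_ne_top _ _))
  refine ⟨2 * (M.toReal + 1), by positivity, fun h hh _ ↦ ?_⟩
  have hinner : ∀ s ∈ Set.Ioc (0 : ℝ) T,
      (∫⁻ ξ, ∫⁻ η, ENNReal.ofReal
        (|‖s • (ξ + η) + h • (ξ + η)‖ ^ (-β) - ‖s • (ξ + η) + h • η‖ ^ (-β)| * s)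
        ∂sphereMeasure ∂sphereMeasure) ≤
      ENNReal.ofReal (2 * h ^ ρ₁) * ENNReal.ofReal (s ^ (1 - (β + ρ₁))) *
        (K * sphereMeasure Set.univ) := by
    intro s hs
    rw [← mul_assoc, ← lintegral_const]
    refine lintegral_mono_ae (ae_sphereMeasure_norm_eq_one.mono fun ξ hξ ↦ ?_)
    refine (lintegral_mono_ae (ae_sphereMeasure_norm_eq_one.mono fun η hη ↦
      ofReal_abs_riesz_increment_le hξ hη hβ0.le hβ2.le hρ0 hρ1'.le hs.1 hh)).trans ?_
    rw [lintegral_const_mul' _ _ (ENNReal.mul_ne_top ENNReal.ofReal_ne_top ENNReal.ofReal_ne_top)]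
    gcongr
    exact hbound ξ hξ
  refine (setLIntegral_mono' measurableSet_Ioc hinner).trans ?_
  rw [lintegral_mul_const' _ _ (ENNReal.mul_ne_top hK (measure_ne_top _ _)),
    lintegral_const_mul' _ _ ENNReal.ofReal_ne_top, ← hI, mul_assoc, ← hM,
    ← ENNReal.ofReal_toReal hMtop, ← ENNReal.ofReal_mul (by positivity)]
  refine ENNReal.ofReal_le_ofReal ?_
  rw [ENNReal.toReal_ofReal ENNReal.toReal_nonneg]
  nlinarith [Real.rpow_pos_of_pos hh ρ₁]
end
end

section
/- Let 0 < β < 2, T > 0, f(x) = |x|^{−β} for x ∈ ℝ³\{0}, and let 0 < ρ₂ < 2−β. Then there exists a constant C > 0 such that for all 0 < h ≤ 1, ∫₀^T ∫_{S²} ∫_{S²} |f(s(ξ+η) + h(ξ+η)) − f(s(ξ+η) + hξ) − f(s(ξ+η) + hη) + f(s(ξ+η))| s² σ(dξ) σ(dη) ds ≤ C h^{ρ₂}. -/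
open MeasureTheory Real
open scoped ENNReal

noncomputable section

lemma rpow_neg_sub_rpow_neg_add_le {x k b θ : ℝ} (hx : 0 < x) (hk : 0 < k) (hb0 : 0 < b)
    (hb1 : b ≤ 1) (hθ0 : 0 ≤ θ) (hθ1 : θ ≤ 1) :
    0 ≤ x ^ (-b) - (x + k) ^ (-b) ∧
      x ^ (-b) - (x + k) ^ (-b) ≤ x ^ (-b) * (k / x) ^ θ := by
  have hxk : 0 < x + k := by positivity
  refine ⟨sub_nonneg.2 (rpow_le_rpow_of_nonpos hx (by linarith) (by linarith)), ?_⟩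
  set z := x / (x + k) with hz
  have hz0 : 0 < z := by positivity
  have hz1 : z ≤ 1 := (div_le_one hxk).2 (by linarith)
  have hw : 1 - z = k / (x + k) := by rw [hz]; field_simp; ring
  have hfac : (x + k) ^ (-b) = x ^ (-b) * z ^ b := by
    rw [hz, div_rpow hx.le hxk.le, rpow_neg hx.le, rpow_neg hxk.le]
    field_simp
  have h1 : z ≤ z ^ b := by
    simpa using rpow_le_rpow_of_exponent_ge hz0 hz1 hb1
  have h2 : k / (x + k) ≤ (k / (x + k)) ^ θ := by
    simpa using rpow_le_rpow_of_exponent_ge (by positivity : 0 < k / (x + k))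
      ((div_le_one hxk).2 (by linarith)) hθ1
  have h3 : (k / (x + k)) ^ θ ≤ (k / x) ^ θ :=
    rpow_le_rpow (by positivity) (by gcongr; linarith) hθ0
  calc x ^ (-b) - (x + k) ^ (-b) = x ^ (-b) * (1 - z ^ b) := by rw [hfac]; ring
    _ ≤ x ^ (-b) * (k / x) ^ θ := by
      gcongr
      linarith

lemma abs_second_difference_rpow_le {s h R β ρ : ℝ} (hs : 0 < s) (hh : 0 < h) (hR : 0 < R)
    (hR2 : R ≤ 2) (hβ0 : 0 < β) (hβ2 : β < 2) (hρ0 : 0 < ρ) (hρ2 : ρ ≤ 2) :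
    |((s + h) * R) ^ (-β) + (s * R) ^ (-β) - 2 * (s * (s + h) * R ^ 2 + h ^ 2) ^ (-(β / 2))|
      ≤ 6 * (s ^ (-(β + ρ)) * h ^ ρ * R ^ (-(β + ρ))) := by
  have hsR : 0 < s * R := by positivity
  have hY : 0 < s * (s + h) * R ^ 2 := by positivity
  obtain ⟨p1, p2⟩ := rpow_neg_sub_rpow_neg_add_le (b := β / 2) (θ := ρ / 2) hsR
    (mul_pos hh hR) (by linarith) (by linarith) (by linarith) (by linarith)
  obtain ⟨q1, q2⟩ := rpow_neg_sub_rpow_neg_add_le (b := β / 2) (θ := ρ / 2) hY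
    (pow_pos hh 2) (by linarith) (by linarith) (by linarith) (by linarith)
  have sq_half : ∀ {x : ℝ} (c : ℝ), 0 < x → (x ^ (c / 2)) ^ 2 = x ^ c := fun {x} c hx ↦ by
    rw [← rpow_natCast, ← rpow_mul hx.le]; congr 1; push_cast; ring
  rw [← add_mul] at p1 p2
  set a := ((s + h) * R) ^ (-(β / 2)) with ha
  set d := (s * R) ^ (-(β / 2)) with hd
  have ha2 : ((s + h) * R) ^ (-β) = a ^ 2 := by
    rw [ha, ← neg_div, sq_half _ (by positivity)]
  have hd2 : (s * R) ^ (-β) = d ^ 2 := by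
    rw [hd, ← neg_div, sq_half _ (by positivity)]
  have had : (s * (s + h) * R ^ 2) ^ (-(β / 2)) = d * a := by
    rw [ha, hd, ← mul_rpow (by positivity) (by positivity)]; congr 1; ring
  have hkx : h * R / (s * R) = h / s := by field_simp
  have e1 : (d - a) ^ 2 ≤ 4 * (s ^ (-(β + ρ)) * h ^ ρ * R ^ (-(β + ρ))) := by
    have hR4 : R ^ ρ ≤ 4 := by
      calc R ^ ρ ≤ 2 ^ ρ := rpow_le_rpow hR.le hR2 hρ0.le
        _ ≤ 2 ^ (2 : ℝ) := rpow_le_rpow_of_exponent_le (by norm_num) hρ2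
        _ = 4 := by norm_num
    calc (d - a) ^ 2 ≤ (d * (h / s) ^ (ρ / 2)) ^ 2 := by
          rw [hkx] at p2; gcongr
      _ = (s * R) ^ (-β) * (h / s) ^ ρ := by rw [mul_pow, hd2, sq_half _ (by positivity)]
      _ = R ^ ρ * (s ^ (-(β + ρ)) * h ^ ρ * R ^ (-(β + ρ))) := by
          rw [mul_rpow hs.le hR.le, div_rpow hh.le hs.le, neg_add, rpow_add hs, rpow_add hR,
            rpow_neg hs.le ρ, rpow_neg hR.le ρ]
          field_simp
      _ ≤ _ := by gcongr
  have e2 : d * a - (s * (s + h) * R ^ 2 + h ^ 2) ^ (-(β / 2))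
      ≤ s ^ (-(β + ρ)) * h ^ ρ * R ^ (-(β + ρ)) := by
    rw [← had]
    refine q2.trans ?_
    have hh2 : (h ^ 2) ^ (ρ / 2) = h ^ ρ := by
      rw [← rpow_natCast, ← rpow_mul hh.le]; congr 1; push_cast; ring
    have hsR2 : ((s * R) ^ 2) ^ (-((β + ρ) / 2)) = (s * R) ^ (-(β + ρ)) := by
      rw [← rpow_natCast, ← rpow_mul hsR.le]; congr 1; push_cast; ring
    calc (s * (s + h) * R ^ 2) ^ (-(β / 2)) * (h ^ 2 / (s * (s + h) * R ^ 2)) ^ (ρ / 2)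
        = (s * (s + h) * R ^ 2) ^ (-((β + ρ) / 2)) * h ^ ρ := by
          rw [div_rpow (by positivity) hY.le, hh2, add_div, neg_add, rpow_add hY,
            rpow_neg hY.le (ρ / 2)]
          field_simp
      _ ≤ ((s * R) ^ 2) ^ (-((β + ρ) / 2)) * h ^ ρ := by
          gcongr ?_ * _
          refine rpow_le_rpow_of_nonpos (by positivity) ?_ (by linarith)
          nlinarith [mul_pos (mul_pos hs hh) (pow_pos hR 2)]
      _ = _ := by rw [hsR2, mul_rpow hs.le hR.le]; ring
  rw [had] at q1
  rw [ha2, hd2, abs_of_nonneg (by nlinarith [sq_nonneg (d - a)])]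
  nlinarith

/-- For unit vectors, the two mixed terms of the second difference coincide. -/
lemma norm_smul_add_add_smul_left {ξ η : E3} (hξ : ‖ξ‖ = 1) (hη : ‖η‖ = 1) {s h β : ℝ} :
    ‖s • (ξ + η) + h • ξ‖ ^ (-β)
      = (s * (s + h) * ‖ξ + η‖ ^ 2 + h ^ 2) ^ (-(β / 2)) := by
  have key : ‖s • (ξ + η) + h • ξ‖ ^ 2 = s * (s + h) * ‖ξ + η‖ ^ 2 + h ^ 2 := by
    have e : s • (ξ + η) + h • ξ = (s + h) • ξ + s • η := by module
    rw [e, norm_add_sq_real, norm_add_sq_real, norm_smul, norm_smul, inner_smul_left,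
      inner_smul_right, hξ, hη, mul_pow, mul_pow]
    simp only [norm_eq_abs, sq_abs, conj_trivial]
    ring
  rw [← key, ← rpow_natCast, ← rpow_mul (norm_nonneg _)]
  congr 1; push_cast; ring

lemma second_difference_le {ξ η : E3} (hξ : ‖ξ‖ = 1) (hη : ‖η‖ = 1) (hne : ξ + η ≠ 0)
    {s h T β ρ : ℝ} (hs : 0 < s) (hsT : s ≤ T) (hh : 0 < h) (hβ0 : 0 < β)
    (hρ0 : 0 < ρ) (hρ2 : ρ < 2 - β) :
    |‖s • (ξ + η) + h • (ξ + η)‖ ^ (-β) - ‖s • (ξ + η) + h • ξ‖ ^ (-β)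
        - ‖s • (ξ + η) + h • η‖ ^ (-β) + ‖s • (ξ + η)‖ ^ (-β)| * s ^ 2
      ≤ 6 * T ^ (2 - (β + ρ)) * h ^ ρ * ‖ξ + η‖⁻¹ ^ (β + ρ) := by
  have hR : 0 < ‖ξ + η‖ := norm_pos_iff.2 hne
  have hR2 : ‖ξ + η‖ ≤ 2 := (norm_add_le _ _).trans (by rw [hξ, hη]; norm_num)
  have e3 : ‖s • (ξ + η) + h • η‖ ^ (-β)
      = (s * (s + h) * ‖ξ + η‖ ^ 2 + h ^ 2) ^ (-(β / 2)) := by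
    rw [add_comm ξ η]; exact norm_smul_add_add_smul_left hη hξ
  rw [e3, norm_smul_add_add_smul_left hξ hη, ← add_smul, norm_smul, norm_smul, norm_eq_abs,
    norm_eq_abs, abs_of_pos hs, abs_of_pos (add_pos hs hh)]
  have main := abs_second_difference_rpow_le hs hh hR hR2 hβ0 (by linarith) hρ0
    (by linarith : ρ ≤ 2)
  have hsq : s ^ (-(β + ρ)) * s ^ 2 = s ^ (2 - (β + ρ)) := by
    rw [← rpow_natCast s 2, ← rpow_add hs]; congr 1; push_cast; ring
  have hsT' : s ^ (2 - (β + ρ)) ≤ T ^ (2 - (β + ρ)) := rpow_le_rpow hs.le hsT (by linarith)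
  rw [inv_rpow hR.le, ← rpow_neg hR.le]
  calc _ ≤ 6 * (s ^ (-(β + ρ)) * h ^ ρ * ‖ξ + η‖ ^ (-(β + ρ))) * s ^ 2 := by
        gcongr ?_ * _
        refine le_trans (le_of_eq ?_) main
        congr 1; ring
    _ = 6 * s ^ (2 - (β + ρ)) * h ^ ρ * ‖ξ + η‖ ^ (-(β + ρ)) := by rw [← hsq]; ring
    _ ≤ _ := by gcongr

open scoped Pointwise in
/-- A spherical cap of radius `r` has area `O(r ^ 2)`. -/
lemma toSphere_cap_le (ξ : Metric.sphere (0 : E3) 1) {r : ℝ} (hr0 : 0 < r) (hr1 : r ≤ 1) :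
    (volume : Measure E3).toSphere {η | ‖(ξ : E3) + η‖ < r}
      ≤ 48 * volume (Metric.ball (0 : E3) 1) * ENNReal.ofReal (r ^ 2) := by
  have hmeas : MeasurableSet {η : Metric.sphere (0 : E3) 1 | ‖(ξ : E3) + η‖ < r} :=
    (isOpen_lt (by fun_prop) (by fun_prop)).measurableSet
  rw [Measure.toSphere_apply' _ hmeas]
  set N := ⌊1 / r⌋₊ + 1 with hN
  have hNr : (N : ℝ) ≤ 2 / r := by
    have h1 := Nat.floor_le (by positivity : (0 : ℝ) ≤ 1 / r)
    have h2 : 1 ≤ 1 / r := (one_le_div hr0).2 hr1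
    have h3 : 2 / r = 1 / r + 1 / r := by ring
    rw [hN]; push_cast; linarith
  have hξ : ‖(ξ : E3)‖ = 1 := norm_eq_of_mem_sphere ξ
  have hsub : Set.Ioo (0 : ℝ) 1 • ((↑) '' {η : Metric.sphere (0 : E3) 1 | ‖(ξ : E3) + η‖ < r})
      ⊆ ⋃ k ∈ Finset.range N, Metric.ball (-((k * r) • (ξ : E3))) (2 * r) := by
    rintro _ ⟨t, ⟨ht0, ht1⟩, _, ⟨η, hη, rfl⟩, rfl⟩
    have hη : ‖(ξ : E3) + η‖ < r := hη
    have k1 : ((⌊t / r⌋₊ : ℕ) : ℝ) * r ≤ t :=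
      (le_div_iff₀ hr0).1 (Nat.floor_le (by positivity))
    have k2 : t < ((⌊t / r⌋₊ : ℕ) + 1 : ℝ) * r := (div_lt_iff₀ hr0).1 (Nat.lt_floor_add_one _)
    simp only [Set.mem_iUnion, Finset.mem_range, Metric.mem_ball, dist_eq_norm]
    refine ⟨⌊t / r⌋₊, Nat.lt_succ_of_le (Nat.floor_le_floor (by gcongr)), ?_⟩
    have e : t • (η : E3) - -((⌊t / r⌋₊ * r) • (ξ : E3))
        = t • ((ξ : E3) + η) - (t - ⌊t / r⌋₊ * r) • (ξ : E3) := by module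
    calc _ ≤ ‖t • ((ξ : E3) + η)‖ + ‖(t - ⌊t / r⌋₊ * r) • (ξ : E3)‖ := by
          rw [e]; exact norm_sub_le _ _
      _ = t * ‖(ξ : E3) + η‖ + (t - ⌊t / r⌋₊ * r) := by
          rw [norm_smul, norm_smul, hξ, norm_eq_abs, norm_eq_abs, abs_of_pos ht0,
            abs_of_nonneg (by linarith), mul_one]
      _ < 2 * r := by nlinarith [norm_nonneg ((ξ : E3) + η)]
  have hvol : volume (Set.Ioo (0 : ℝ) 1 •
        ((↑) '' {η : Metric.sphere (0 : E3) 1 | ‖(ξ : E3) + η‖ < r}) : Set E3)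
      ≤ 16 * ENNReal.ofReal (r ^ 2) * volume (Metric.ball (0 : E3) 1) := by
    refine (measure_mono hsub).trans ((measure_biUnion_finset_le _ _).trans ?_)
    simp only [Measure.addHaar_ball volume _ (by positivity : 0 ≤ 2 * r), Finset.sum_const,
      Finset.card_range, nsmul_eq_mul, finrank_euclideanSpace, Fintype.card_fin]
    rw [← mul_assoc]
    gcongr ?_ * _
    rw [← ENNReal.ofReal_natCast, ← ENNReal.ofReal_mul (by positivity),
      ← ENNReal.ofReal_ofNat 16, ← ENNReal.ofReal_mul (by positivity)]
    refine ENNReal.ofReal_le_ofReal ?_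
    calc (N : ℝ) * (2 * r) ^ 3 ≤ 2 / r * (2 * r) ^ 3 := by gcongr
      _ = 16 * r ^ 2 := by field_simp; ring
  refine (mul_le_mul_right hvol _).trans (le_of_eq ?_)
  simp only [finrank_euclideanSpace, Fintype.card_fin]
  push_cast
  ring

lemma ae_toSphere_add_ne_zero (ξ : Metric.sphere (0 : E3) 1) :
    ∀ᵐ η : Metric.sphere (0 : E3) 1 ∂(volume : Measure E3).toSphere, (ξ : E3) + η ≠ 0 := by
  rw [ae_iff]
  have hlim : Filter.Tendsto (fun r : ℝ ↦ 48 * volume (Metric.ball (0 : E3) 1) *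
      ENNReal.ofReal (r ^ 2)) (nhdsWithin 0 (Set.Ioi 0)) (nhds 0) := by
    have h1 : Filter.Tendsto (fun r : ℝ ↦ ENNReal.ofReal (r ^ 2)) (nhds 0) (nhds 0) := by
      have : Continuous fun r : ℝ ↦ ENNReal.ofReal (r ^ 2) := 
        ENNReal.continuous_ofReal.comp (continuous_pow 2)
      simpa using this.tendsto 0
    have h2 := ENNReal.Tendsto.const_mul (a := 48 * volume (Metric.ball (0 : E3) 1)) h1
      (.inr (ENNReal.mul_ne_top (by simp) measure_ball_lt_top.ne))
    rw [mul_zero] at h2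
    exact h2.mono_left nhdsWithin_le_nhds
  refine le_antisymm (ge_of_tendsto hlim ?_) bot_le
  filter_upwards [Ioc_mem_nhdsGT one_pos] with r hr
  refine (measure_mono fun η hη ↦ ?_).trans (toSphere_cap_le ξ hr.1 hr.2)
  have hη : (ξ : E3) + η = 0 := not_not.1 hη
  simpa [hη] using hr.1

/-- The singular kernel `‖ξ + η‖ ^ (-q)` with `q < 2` is integrable on the sphere, uniformly in
the unit vector `ξ`. -/
lemma exists_lintegral_inv_norm_add_rpow_le {q : ℝ} (hq0 : 0 < q) (hq2 : q < 2) :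
    ∃ K : ℝ≥0∞, K ≠ ∞ ∧ ∀ ξ : Metric.sphere (0 : E3) 1,
      ∫⁻ η : Metric.sphere (0 : E3) 1, ENNReal.ofReal (‖(ξ : E3) + η‖⁻¹ ^ q)
        ∂(volume : Measure E3).toSphere ≤ K := by
  set V := 48 * volume (Metric.ball (0 : E3) 1)
  have hVt : V ≠ ∞ := ENNReal.mul_ne_top (by simp) measure_ball_lt_top.ne
  set M := (volume : Measure E3).toSphere Set.univ
  have hMt : M ≠ ∞ := measure_ne_top _ _
  set A := ∫⁻ t in Set.Ioc (0 : ℝ) 1, ENNReal.ofReal (t ^ (q - 1))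
  set B := ∫⁻ t in Set.Ioi (1 : ℝ), ENNReal.ofReal (t ^ (q - 3))
  have hA : A ≠ ∞ := by
    have : IntegrableOn (fun t : ℝ ↦ t ^ (q - 1)) (Set.Ioc 0 1) :=
      (intervalIntegrable_iff_integrableOn_Ioc_of_le zero_le_one).1
        (intervalIntegral.intervalIntegrable_rpow' (by linarith))
    exact this.lintegral_lt_top.ne
  have hB : B ≠ ∞ :=
    (integrableOn_Ioi_rpow_of_lt (by linarith : q - 3 < -1) one_pos).lintegral_lt_top.ne
  refine ⟨ENNReal.ofReal q * (M * A + V * B), by finiteness, fun ξ ↦ ?_⟩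
  rw [lintegral_rpow_eq_lintegral_meas_lt_mul _ (.of_forall fun η ↦ by positivity)
    (by fun_prop) hq0]
  gcongr
  rw [← Set.Ioc_union_Ioi_eq_Ioi (zero_le_one : (0 : ℝ) ≤ 1)]
  refine (lintegral_union_le _ _ _).trans (add_le_add ?_ ?_)
  · rw [← lintegral_const_mul' _ _ hMt]
    gcongr
    exact measure_mono (Set.subset_univ _)
  · rw [← lintegral_const_mul' _ _ hVt]
    refine setLIntegral_mono' measurableSet_Ioi fun t ht ↦ ?_
    have ht1 : 1 < t := ht
    have ht0 : 0 < t := one_pos.trans ht1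
    have hsub : {η : Metric.sphere (0 : E3) 1 | t < ‖(ξ : E3) + η‖⁻¹}
        ⊆ {η | ‖(ξ : E3) + η‖ < t⁻¹} := fun η hη ↦ by
      have hη : t < ‖(ξ : E3) + η‖⁻¹ := hη
      exact (lt_inv_comm₀ ht0 (inv_pos.1 (ht0.trans hη))).1 hη
    calc _ ≤ V * ENNReal.ofReal (t⁻¹ ^ 2) * ENNReal.ofReal (t ^ (q - 1)) := by
          gcongr
          exact (measure_mono hsub).trans
            (toSphere_cap_le ξ (inv_pos.2 ht0) (inv_le_one_of_one_le₀ ht1.le))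
      _ = V * ENNReal.ofReal (t ^ (q - 3)) := by
          rw [mul_assoc, ← ENNReal.ofReal_mul (by positivity)]
          congr 2
          rw [show q - 1 = (q - 3) + (2 : ℕ) by push_cast; ring, rpow_add ht0, rpow_natCast]
          field_simp

lemma lintegral_sphereMeasure (f : E3 → ℝ≥0∞) :
    ∫⁻ x, f x ∂sphereMeasure
      = ∫⁻ x : Metric.sphere (0 : E3) 1, f x ∂(volume : Measure E3).toSphere :=
  (MeasurableEmbedding.subtype_coe Metric.isClosed_sphere.measurableSet).lintegral_map f

/-- Proposition 5.2, condition (4.2), for the Riesz kernel `f(x) = |x|^{-β}`, `0 < β < 2`: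
for `0 < ρ₂ < 2-β` there is `C > 0` such that for all `0 < h ≤ 1`,
`∫₀^T ∫_{S²} ∫_{S²} |f(s(ξ+η)+h(ξ+η)) - f(s(ξ+η)+hξ) - f(s(ξ+η)+hη) + f(s(ξ+η))| s²
  σ(dξ) σ(dη) ds ≤ C h^{ρ₂}`. -/
theorem riesz_time_condition_two
    (β T ρ₂ : ℝ) (hβ0 : 0 < β) (hβ2 : β < 2) (hT : 0 < T)
    (hρ0 : 0 < ρ₂) (hρ2 : ρ₂ < 2 - β) :
    ∃ C : ℝ, 0 < C ∧ ∀ h : ℝ, 0 < h → h ≤ 1 →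
      (∫⁻ s in Set.Ioc (0 : ℝ) T, ∫⁻ ξ, ∫⁻ η,
          ENNReal.ofReal
            (|‖s • (ξ + η) + h • (ξ + η)‖ ^ (-β) - ‖s • (ξ + η) + h • ξ‖ ^ (-β)
                - ‖s • (ξ + η) + h • η‖ ^ (-β) + ‖s • (ξ + η)‖ ^ (-β)| * s ^ 2)
        ∂sphereMeasure ∂sphereMeasure)
      ≤ ENNReal.ofReal (C * h ^ ρ₂) := by
  obtain ⟨K, hK, hKle⟩ := exists_lintegral_inv_norm_add_rpow_le (q := β + ρ₂)
    (by linarith) (by linarith)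
  set M := (volume : Measure E3).toSphere Set.univ
  have hMt : M ≠ ∞ := measure_ne_top _ _
  set c := 6 * T ^ (2 - (β + ρ₂))
  have hc0 : 0 < c := by positivity
  obtain ⟨L, hL0, hL⟩ : ∃ L : ℝ, 0 ≤ L ∧ K * M = ENNReal.ofReal L :=
    ⟨_, ENNReal.toReal_nonneg, (ENNReal.ofReal_toReal (ENNReal.mul_ne_top hK hMt)).symm⟩
  refine ⟨c * L * T + 1, by positivity, fun h hh _ ↦ ?_⟩
  have inner_le : ∀ s ∈ Set.Ioc (0 : ℝ) T, (∫⁻ ξ, ∫⁻ η,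
      ENNReal.ofReal
        (|‖s • (ξ + η) + h • (ξ + η)‖ ^ (-β) - ‖s • (ξ + η) + h • ξ‖ ^ (-β)
            - ‖s • (ξ + η) + h • η‖ ^ (-β) + ‖s • (ξ + η)‖ ^ (-β)| * s ^ 2)
      ∂sphereMeasure ∂sphereMeasure) ≤ ENNReal.ofReal (c * h ^ ρ₂) * K * M := by
    intro s hs
    rw [lintegral_sphereMeasure, ← lintegral_const]
    refine lintegral_mono fun ξ ↦ ?_
    rw [lintegral_sphereMeasure]
    refine le_trans ?_ (mul_le_mul_right (hKle ξ) _)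
    rw [← lintegral_const_mul' _ _ ENNReal.ofReal_ne_top]
    refine lintegral_mono_ae ?_
    filter_upwards [ae_toSphere_add_ne_zero ξ] with η hη
    rw [← ENNReal.ofReal_mul (by positivity)]
    exact ENNReal.ofReal_le_ofReal (second_difference_le (norm_eq_of_mem_sphere ξ)
      (norm_eq_of_mem_sphere η) hη hs.1 hs.2 hh hβ0 hρ0 hρ2)
  refine (setLIntegral_mono' measurableSet_Ioc inner_le).trans ?_
  rw [setLIntegral_const, Real.volume_Ioc, sub_zero, mul_assoc _ K M,
    hL, ← ENNReal.ofReal_mul (by positivity), ← ENNReal.ofReal_mul (by positivity)]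
  refine ENNReal.ofReal_le_ofReal ?_
  have : 0 < h ^ ρ₂ := by positivity
  nlinarith
end
end

section
/- Let α > 1, T > 0, let f be the Bessel kernel on ℝ³, and let 0 < ν < min(α−1, 1). Then there exists a constant C > 0 such that for all 0 < h ≤ 2T, ∫_{|x| ≤ h} f(x)/|x| dx ≤ C h^{ν}. -/
open MeasureTheory Real
open scoped ENNReal

noncomputable section

/-- The Bessel kernel on `ℝ³` with parameter `α`:
`f(x) = ∫₀^∞ w^{(α-5)/2} e^{-w} e^{-|x|²/(4w)} dw`. -/
def besselKernel (α : ℝ) (x : E3) : ℝ :=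
  ∫ w in Set.Ioi (0 : ℝ), w ^ ((α - 5) / 2) * Real.exp (-w) * Real.exp (-‖x‖ ^ 2 / (4 * w))

open Set Module in
theorem lintegral_closedBall_norm_rpow_sub_finrank {E : Type*} [NormedAddCommGroup E]
    [NormedSpace ℝ E] [FiniteDimensional ℝ E] [Nontrivial E] [MeasurableSpace E] [BorelSpace E]
    (μ : Measure E) [μ.IsAddHaarMeasure] {s h : ℝ} (hs : 0 < s) (hh : 0 ≤ h) :
    ∫⁻ x in Metric.closedBall (0 : E) h, ENNReal.ofReal (‖x‖ ^ (s - finrank ℝ E)) ∂μ =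
      ENNReal.ofReal (finrank ℝ E * μ.real (Metric.ball 0 1) * (h ^ s / s)) := by
  set g : ℝ → ℝ := (Iic h).indicator fun r ↦ r ^ (s - finrank ℝ E)
  have hpow : ∀ r ∈ Ioi (0 : ℝ), r ^ (finrank ℝ E - 1) • g r =
      (Iic h).indicator (fun r ↦ r ^ (s - 1)) r := by
    intro r (hr : 0 < r)
    by_cases hrh : r ≤ h
    · have hd : 1 ≤ finrank ℝ E := finrank_pos
      simp only [g, indicator_of_mem (mem_Iic.2 hrh), smul_eq_mul]
      rw [← rpow_natCast, ← rpow_add hr, Nat.cast_sub hd]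
      congr 1
      push_cast
      ring
    · simp [g, hrh]
  have hint : IntegrableOn (fun r : ℝ ↦ r ^ (s - 1)) (Ioc 0 h) :=
    (intervalIntegral.intervalIntegrable_rpow' (a := 0) (b := h) (by linarith)).1
  have hgint : Integrable (fun x : E ↦ g ‖x‖) μ := by
    rw [integrable_fun_norm_addHaar, integrableOn_congr_fun hpow measurableSet_Ioi,
      IntegrableOn, integrable_indicator_iff measurableSet_Iic, IntegrableOn,
      Measure.restrict_restrict measurableSet_Iic, Iic_inter_Ioi]
    exact hint
  have hg0 : ∀ x : E, 0 ≤ g ‖x‖ := fun x ↦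
    indicator_apply_nonneg fun _ ↦ rpow_nonneg (norm_nonneg x) _
  calc
    _ = ∫⁻ x, ENNReal.ofReal (g ‖x‖) ∂μ := by
      rw [← lintegral_indicator measurableSet_closedBall]
      refine lintegral_congr fun x ↦ ?_
      by_cases hx : ‖x‖ ≤ h <;> simp [g, hx]
    _ = _ := by
      rw [← ofReal_integral_eq_lintegral_ofReal hgint (.of_forall hg0),
        integral_fun_norm_addHaar, setIntegral_congr_fun measurableSet_Ioi hpow,
        integral_indicator measurableSet_Iic, Measure.restrict_restrict measurableSet_Iic,
        Iic_inter_Ioi, ← intervalIntegral.integral_of_le hh, integral_rpow (.inl (by linarith))]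
      simp [zero_rpow hs.ne', mul_assoc]

theorem Real.exp_neg_le_rpow_neg {y s : ℝ} (hy : 0 < y) (hs0 : 0 ≤ s) (hs1 : s ≤ 1) :
    Real.exp (-y) ≤ y ^ (-s) := by
  rw [Real.exp_neg, rpow_neg hy.le]
  gcongr
  calc
    y ^ s ≤ (1 + y) ^ s := by gcongr; linarith
    _ ≤ (1 + y) ^ (1 : ℝ) := rpow_le_rpow_of_exponent_le (by linarith) hs1
    _ ≤ Real.exp y := by rw [rpow_one, add_comm]; exact Real.add_one_le_exp y

theorem besselKernel_le {α s : ℝ} (hs0 : 0 ≤ s) (hs1 : s ≤ 1) (hα : 3 - α < 2 * s) {x : E3}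
    (hx : x ≠ 0) :
    besselKernel α x ≤ 4 ^ s * Real.Gamma ((α - 3) / 2 + s) * ‖x‖ ^ (-(2 * s)) := by
  have hn : 0 < ‖x‖ := norm_pos_iff.2 hx
  have hpos : 0 < (α - 3) / 2 + s := by linarith
  rw [Real.Gamma_eq_integral hpos, mul_right_comm, ← integral_const_mul, besselKernel]
  refine integral_mono_of_nonneg ?_ ((Real.GammaIntegral_convergent hpos).const_mul _) ?_
  · filter_upwards [ae_restrict_mem measurableSet_Ioi] with w (hw : 0 < w)
    positivity
  · filter_upwards [ae_restrict_mem measurableSet_Ioi] with w (hw : 0 < w)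
    have hexp : Real.exp (-‖x‖ ^ 2 / (4 * w)) ≤ 4 ^ s * ‖x‖ ^ (-(2 * s)) * w ^ s := by
      rw [neg_div]
      refine (Real.exp_neg_le_rpow_neg (by positivity) hs0 hs1).trans_eq ?_
      rw [div_rpow (by positivity) (by positivity), mul_rpow (by positivity) hw.le,
        ← rpow_natCast, ← rpow_mul hn.le, rpow_neg hw.le, rpow_neg (by positivity : (0 : ℝ) ≤ 4)]
      field_simp
      congr 1
      push_cast
      ring
    calc
      _ ≤ w ^ ((α - 5) / 2) * Real.exp (-w) * (4 ^ s * ‖x‖ ^ (-(2 * s)) * w ^ s) := by gcongr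
      _ = 4 ^ s * ‖x‖ ^ (-(2 * s)) * (Real.exp (-w) * (w ^ ((α - 5) / 2) * w ^ s)) := by ring
      _ = _ := by
        rw [← rpow_add hw]
        congr 3
        ring

/-- Proposition 5.3, condition (1) of Theorem 4.1 for the Bessel kernel: for `α > 1`
and `0 < ν < min(α-1, 1)` there is `C > 0` such that for all `0 < h ≤ 2T`,
`∫_{|x| ≤ h} f(x)/|x| dx ≤ C h^ν`. -/
theorem bessel_condition_one
    (α T ν : ℝ) (hα : 1 < α) (hT : 0 < T)
    (hν0 : 0 < ν) (hν : ν < min (α - 1) 1) :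
    ∃ C : ℝ, 0 < C ∧ ∀ h : ℝ, 0 < h → h ≤ 2 * T →
      (∫⁻ x in Metric.closedBall (0 : E3) h, ENNReal.ofReal (besselKernel α x / ‖x‖))
        ≤ ENNReal.ofReal (C * h ^ ν) := by
  obtain ⟨hνα, hν1⟩ := lt_min_iff.1 hν
  set s : ℝ := 1 - ν / 2 with hs
  set A : ℝ := 4 ^ s * Real.Gamma ((α - 3) / 2 + s)
  have hA : 0 < A := mul_pos (by positivity) (Real.Gamma_pos_of_pos (by linarith))
  set B : ℝ := 3 * volume.real (Metric.ball (0 : E3) 1) / ν with hB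
  have hball : 0 < volume.real (Metric.ball (0 : E3) 1) :=
    ENNReal.toReal_pos (Metric.measure_ball_pos _ _ one_pos).ne' measure_ball_lt_top.ne
  refine ⟨A * B, by positivity, fun h hh _ ↦ ?_⟩
  have hle (x : E3) :
      ENNReal.ofReal (besselKernel α x / ‖x‖) ≤
        ENNReal.ofReal A * ENNReal.ofReal (‖x‖ ^ (ν - Module.finrank ℝ E3)) := by
    rcases eq_or_ne x 0 with rfl | hx
    · simp
    have hn : 0 < ‖x‖ := norm_pos_iff.2 hx
    rw [← ENNReal.ofReal_mul hA.le]
    refine ENNReal.ofReal_le_ofReal ?_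
    rw [div_le_iff₀ hn, mul_assoc, ← rpow_add_one hn.ne']
    have hexp : ν - Module.finrank ℝ E3 + 1 = -(2 * s) := by
      rw [finrank_euclideanSpace_fin, hs]
      push_cast
      ring
    rw [hexp]
    exact besselKernel_le (by linarith) (by linarith) (by linarith) hx
  calc
    _ ≤ ∫⁻ x in Metric.closedBall (0 : E3) h,
          ENNReal.ofReal A * ENNReal.ofReal (‖x‖ ^ (ν - Module.finrank ℝ E3)) :=
      lintegral_mono hle
    _ = ENNReal.ofReal (A * B * h ^ ν) := by
      rw [lintegral_const_mul' _ _ ENNReal.ofReal_ne_top,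
        lintegral_closedBall_norm_rpow_sub_finrank _ hν0 hh.le, ← ENNReal.ofReal_mul hA.le,
        finrank_euclideanSpace_fin, hB]
      congr 1
      push_cast
      ring
end
end

section
/- Let α > 1, T > 0, let f be the Bessel kernel on ℝ³, and let 0 < γ < min(α−1, 1). Then there exists a constant C > 0 such that for all y ∈ ℝ³, ∫_{|z| ≤ 2T} |f(z+y) − f(z)| / |z| dz ≤ C |y|^{γ}. -/
open MeasureTheory Real
open scoped ENNReal

noncomputable section

/-- A power decay bound for the exponential. -/
lemma exp_neg_le_rpow_neg {p x : ℝ} (hp0 : 0 ≤ p) (hp1 : p ≤ 1) (hx : 0 < x) :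
    exp (-x) ≤ x ^ (-p) := by
  rw [rpow_def_of_pos hx]
  apply exp_le_exp.2
  have h1 : log x ≤ x := (log_le_sub_one_of_pos hx).trans (by linarith)
  nlinarith

/-- The Gaussian `t ↦ exp (-t²)` is `1`-Lipschitz. -/
lemma abs_exp_neg_sq_sub_le (a b : ℝ) :
    |exp (-a ^ 2) - exp (-b ^ 2)| ≤ |a - b| := by
  have hd : ∀ x ∈ (Set.univ : Set ℝ),
      HasDerivWithinAt (fun t : ℝ => exp (-t ^ 2)) (exp (-x ^ 2) * (-(2 * x))) Set.univ x := by
    intro x _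
    have h : HasDerivAt (fun t : ℝ => -t ^ 2) (-(2 * x)) x := by
      simpa using (hasDerivAt_pow 2 x).fun_neg
    exact h.exp.hasDerivWithinAt
  have hb : ∀ x ∈ (Set.univ : Set ℝ), ‖exp (-x ^ 2) * (-(2 * x))‖ ≤ 1 := by
    intro x _
    have h1 : x ^ 2 + 1 ≤ exp (x ^ 2) := add_one_le_exp _
    have h2 : |2 * x| ≤ x ^ 2 + 1 := by
      rw [abs_le]; constructor <;> nlinarith [sq_nonneg (x - 1), sq_nonneg (x + 1)]
    rw [norm_mul, norm_neg, norm_eq_abs, norm_eq_abs, abs_of_pos (exp_pos _), exp_neg,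
      inv_mul_le_iff₀ (exp_pos _), mul_one]
    exact h2.trans h1
  simpa using convex_univ.norm_image_sub_le_of_norm_hasDerivWithin_le hd hb
    (Set.mem_univ b) (Set.mem_univ a)

/-- Hölder estimate in the spatial variable for the heat kernel profile, with a power decay
in the smaller radius. -/
lemma abs_exp_sub_exp_le_of_le {γ p r s w : ℝ} (hγ0 : 0 < γ) (hγ1 : γ < 1) (hp0 : 0 ≤ p)
    (hp1 : p ≤ 1) (hr : 0 < r) (hrs : r ≤ s) (hw : 0 < w) :
    |exp (-r ^ 2 / (4 * w)) - exp (-s ^ 2 / (4 * w))| ≤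
      ((1 - γ) / 4) ^ (-p) * |r - s| ^ γ * r ^ (-(2 * p)) * w ^ (p - γ / 2) := by
  set D := |exp (-r ^ 2 / (4 * w)) - exp (-s ^ 2 / (4 * w))| with hD
  have hD0 : 0 ≤ D := abs_nonneg _
  have hanti : exp (-s ^ 2 / (4 * w)) ≤ exp (-r ^ 2 / (4 * w)) := by
    apply exp_le_exp.2
    gcongr
  have hDA : D ≤ exp (-r ^ 2 / (4 * w)) := by
    rw [hD, abs_of_nonneg (sub_nonneg.2 hanti)]
    linarith [exp_pos (-s ^ 2 / (4 * w))]
  have hsw : 0 < √w := sqrt_pos.2 hw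
  have hsq : ∀ t : ℝ, -t ^ 2 / (4 * w) = -(t / (2 * √w)) ^ 2 := by
    intro t
    rw [div_pow, mul_pow, sq_sqrt hw.le]
    ring
  have hDL : D ≤ |r - s| * w ^ (-(1 / 2) : ℝ) := by
    rw [hD, hsq, hsq]
    refine (abs_exp_neg_sq_sub_le _ _).trans ?_
    rw [← sub_div, abs_div, abs_of_pos (by positivity : 0 < 2 * √w), rpow_neg hw.le,
      ← sqrt_eq_rpow, ← div_eq_mul_inv]
    gcongr
    linarith
  have h1γ : 0 < 1 - γ := by linarith
  have hA : exp (-r ^ 2 / (4 * w)) ^ (1 - γ) ≤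
      ((1 - γ) / 4) ^ (-p) * r ^ (-(2 * p)) * w ^ p := by
    rw [← exp_mul]
    have h := exp_neg_le_rpow_neg hp0 hp1 (x := (1 - γ) / 4 * (r ^ (2 : ℝ) * w ^ (-1 : ℝ)))
      (by positivity)
    rw [mul_rpow (by positivity) (by positivity), mul_rpow (by positivity) (by positivity),
      ← rpow_mul hr.le, ← rpow_mul hw.le] at h
    convert h using 1
    · congr 1
      rw [rpow_neg_one, rpow_two]
      field_simp
    · rw [mul_assoc]
      congr 3 <;> ring_nf
  calc D = D ^ (1 - γ) * D ^ γ := by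
        rw [← rpow_add_of_nonneg hD0 h1γ.le hγ0.le]; simp
    _ ≤ exp (-r ^ 2 / (4 * w)) ^ (1 - γ) * (|r - s| * w ^ (-(1 / 2) : ℝ)) ^ γ := by
        gcongr
    _ ≤ (((1 - γ) / 4) ^ (-p) * r ^ (-(2 * p)) * w ^ p) *
          (|r - s| * w ^ (-(1 / 2) : ℝ)) ^ γ := by gcongr
    _ = ((1 - γ) / 4) ^ (-p) * |r - s| ^ γ * r ^ (-(2 * p)) * (w ^ p * w ^ (-(γ / 2))) := by
        rw [mul_rpow (abs_nonneg _) (by positivity), ← rpow_mul hw.le]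
        ring_nf
    _ = _ := by rw [← rpow_add hw]; ring_nf

/-- Hölder estimate in the spatial variable for the heat kernel profile. -/
lemma abs_exp_sub_exp_le {γ p r s w : ℝ} (hγ0 : 0 < γ) (hγ1 : γ < 1) (hp0 : 0 ≤ p)
    (hp1 : p ≤ 1) (hr : 0 < r) (hs : 0 < s) (hw : 0 < w) :
    |exp (-r ^ 2 / (4 * w)) - exp (-s ^ 2 / (4 * w))| ≤
      ((1 - γ) / 4) ^ (-p) * |r - s| ^ γ * (r ^ (-(2 * p)) + s ^ (-(2 * p))) *
        w ^ (p - γ / 2) := by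
  have h1γ : 0 < 1 - γ := by linarith
  rcases le_total r s with h | h
  · refine (abs_exp_sub_exp_le_of_le hγ0 hγ1 hp0 hp1 hr h hw).trans ?_
    gcongr
    exact le_add_of_nonneg_right (by positivity)
  · rw [abs_sub_comm, abs_sub_comm r s]
    refine (abs_exp_sub_exp_le_of_le hγ0 hγ1 hp0 hp1 hs h hw).trans ?_
    gcongr
    exact le_add_of_nonneg_left (by positivity)

lemma integrableOn_rpow_mul_exp_neg {a : ℝ} (ha : -1 < a) :
    IntegrableOn (fun w : ℝ => w ^ a * exp (-w)) (Set.Ioi 0) := by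
  have h := GammaIntegral_convergent (s := a + 1) (by linarith)
  simpa [mul_comm] using h

/-- The integral defining the Bessel kernel converges away from the origin. -/
lemma integrableOn_besselKernel {α : ℝ} (hα : 1 < α) {x : E3} (hx : x ≠ 0) :
    IntegrableOn (fun w : ℝ => w ^ ((α - 5) / 2) * exp (-w) * exp (-‖x‖ ^ 2 / (4 * w)))
      (Set.Ioi 0) := by
  have hx' : 0 < ‖x‖ := norm_pos_iff.2 hx
  have hi := (integrableOn_rpow_mul_exp_neg (a := (α - 5) / 2 + 1) (by linarith)).const_mul
    ((‖x‖ ^ 2 / 4)⁻¹)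
  refine Integrable.mono' hi (by fun_prop) ?_
  filter_upwards [ae_restrict_mem measurableSet_Ioi] with w hw
  have hw : 0 < w := hw
  rw [norm_of_nonneg (by positivity)]
  have h := exp_neg_le_rpow_neg zero_le_one le_rfl (x := ‖x‖ ^ 2 / (4 * w)) (by positivity)
  calc w ^ ((α - 5) / 2) * exp (-w) * exp (-‖x‖ ^ 2 / (4 * w))
      ≤ w ^ ((α - 5) / 2) * exp (-w) * (‖x‖ ^ 2 / (4 * w)) ^ (-1 : ℝ) := by
        rw [neg_div]; gcongr
    _ = (‖x‖ ^ 2 / 4)⁻¹ * (w ^ ((α - 5) / 2 + 1) * exp (-w)) := by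
        rw [rpow_add hw, rpow_one, rpow_neg_one]
        field_simp

/-- Pointwise Hölder estimate for the Bessel kernel away from the origin. -/
lemma exists_abs_besselKernel_sub_le {α γ p : ℝ} (hα : 1 < α) (hγ0 : 0 < γ) (hγ1 : γ < 1)
    (hp0 : 0 ≤ p) (hp1 : p ≤ 1) (hp : (3 + γ - α) / 2 < p) :
    ∃ M : ℝ, 0 ≤ M ∧ ∀ x z : E3, x ≠ 0 → z ≠ 0 →
      |besselKernel α x - besselKernel α z| ≤
        M * ‖x - z‖ ^ γ * (‖x‖ ^ (-(2 * p)) + ‖z‖ ^ (-(2 * p))) := by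
  have h1γ : 0 < 1 - γ := by linarith
  have hG := integrableOn_rpow_mul_exp_neg (a := (α - 5) / 2 + (p - γ / 2)) (by linarith)
  set G := ∫ w in Set.Ioi (0 : ℝ), w ^ ((α - 5) / 2 + (p - γ / 2)) * exp (-w)
  have hG0 : 0 ≤ G := setIntegral_nonneg measurableSet_Ioi fun w hw => by
    have hw : 0 < w := hw
    positivity
  refine ⟨((1 - γ) / 4) ^ (-p) * G, by positivity, fun x z hx hz => ?_⟩
  have hx' : 0 < ‖x‖ := norm_pos_iff.2 hx
  have hz' : 0 < ‖z‖ := norm_pos_iff.2 hz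
  set K := ((1 - γ) / 4) ^ (-p) * ‖x - z‖ ^ γ * (‖x‖ ^ (-(2 * p)) + ‖z‖ ^ (-(2 * p))) with hK
  have hsub : besselKernel α x - besselKernel α z = ∫ w in Set.Ioi (0 : ℝ),
      (w ^ ((α - 5) / 2) * exp (-w) * exp (-‖x‖ ^ 2 / (4 * w)) -
        w ^ ((α - 5) / 2) * exp (-w) * exp (-‖z‖ ^ 2 / (4 * w))) :=
    (integral_sub (integrableOn_besselKernel hα hx) (integrableOn_besselKernel hα hz)).symm
  calc |besselKernel α x - besselKernel α z|
      ≤ ∫ w in Set.Ioi (0 : ℝ), K * (w ^ ((α - 5) / 2 + (p - γ / 2)) * exp (-w)) := by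
        rw [hsub, ← norm_eq_abs]
        refine norm_integral_le_of_norm_le (hG.const_mul K) ?_
        filter_upwards [ae_restrict_mem measurableSet_Ioi] with w hw
        have hw : 0 < w := hw
        rw [← mul_sub, norm_mul, norm_of_nonneg (by positivity), norm_eq_abs]
        calc _ ≤ w ^ ((α - 5) / 2) * exp (-w) * (((1 - γ) / 4) ^ (-p) * |‖x‖ - ‖z‖| ^ γ *
                (‖x‖ ^ (-(2 * p)) + ‖z‖ ^ (-(2 * p))) * w ^ (p - γ / 2)) := by
              gcongr
              exact abs_exp_sub_exp_le hγ0 hγ1 hp0 hp1 hx' hz' hw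
          _ ≤ w ^ ((α - 5) / 2) * exp (-w) * (K * w ^ (p - γ / 2)) := by
              rw [hK]
              gcongr
              exact abs_norm_sub_norm_le x z
          _ = K * (w ^ ((α - 5) / 2 + (p - γ / 2)) * exp (-w)) := by
              rw [rpow_add hw]; ring
    _ = K * G := by rw [integral_const_mul]
    _ = _ := by rw [hK]; ring

/-- The integral over `S` of a translate of a negative power of the norm is bounded uniformly
in the translation. -/
lemma lintegral_norm_add_rpow_neg_le {s : ℝ} (hs0 : 0 ≤ s) (S : Set E3) (y : E3) :
    ∫⁻ z in S, ENNReal.ofReal (‖z + y‖ ^ (-s)) ≤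
      (∫⁻ u in Metric.ball (0 : E3) 1, ENNReal.ofReal (‖u‖ ^ (-s))) + volume S := by
  set F : E3 → ℝ≥0∞ :=
    (Metric.ball (0 : E3) 1).indicator fun u => ENNReal.ofReal (‖u‖ ^ (-s)) with hF
  have hFm : Measurable F := by
    refine Measurable.indicator ?_ measurableSet_ball
    fun_prop
  calc ∫⁻ z in S, ENNReal.ofReal (‖z + y‖ ^ (-s))
      ≤ ∫⁻ z in S, (F (z + y) + 1) := by
        refine lintegral_mono fun z => ?_
        by_cases h : z + y ∈ Metric.ball (0 : E3) 1
        · simp only [hF, Set.indicator_of_mem h]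
          exact le_self_add
        · have h1 : 1 ≤ ‖z + y‖ := by simpa using h
          simp only [hF, Set.indicator_of_notMem h, zero_add]
          exact ENNReal.ofReal_le_one.2 (rpow_le_one_of_one_le_of_nonpos h1 (by linarith))
    _ = (∫⁻ z in S, F (z + y)) + volume S := by
        rw [lintegral_add_right _ measurable_const]; simp
    _ ≤ (∫⁻ z, F (z + y)) + volume S := by
        gcongr
        exact Measure.restrict_le_self
    _ = _ := by
        rw [lintegral_add_right_eq_self F y, hF, lintegral_indicator measurableSet_ball]

lemma lintegral_ball_norm_rpow_neg_lt_top {s : ℝ} (hs : s < 3) :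
    ∫⁻ u in Metric.ball (0 : E3) 1, ENNReal.ofReal (‖u‖ ^ (-s)) < ∞ := by
  have h : IntegrableOn (fun u : E3 => ‖u‖ ^ (-s)) (Metric.ball 0 1) volume := by
    refine integrableOn_ball_of_norm_le_rpow (C := 1) (α := s) (by simp) (by simpa using hs) ?_ ?_
    · refine Filter.Eventually.of_forall fun x => ?_
      rw [one_mul, norm_of_nonneg (by positivity)]
    · exact (by fun_prop : Measurable fun u : E3 => ‖u‖ ^ (-s)).aestronglyMeasurable
  exact h.lintegral_lt_top

/-- Rearrangement-type inequality separating a product of negative powers. -/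
lemma rpow_neg_div_le {a b q : ℝ} (hq : 0 ≤ q) (ha : 0 < a) (hb : 0 < b) :
    a ^ (-q) / b ≤ a ^ (-(q + 1)) + b ^ (-(q + 1)) := by
  have h : ∀ c : ℝ, 0 < c → c ^ (-(q + 1)) = c ^ (-q) * c⁻¹ := fun c hc => by
    rw [neg_add, rpow_add hc, rpow_neg_one]
  rw [h a ha, h b hb, div_eq_mul_inv]
  rcases le_total a b with hab | hab
  · refine le_add_of_le_of_nonneg ?_ (by positivity)
    gcongr
  · refine le_add_of_nonneg_of_le (by positivity) ?_
    gcongr ?_ * _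
    exact rpow_le_rpow_of_nonpos hb hab (by linarith)

/-- Proposition 5.3, condition (3.1) for the Bessel kernel: for `α > 1` and
`0 < γ < min(α-1, 1)` there is `C > 0` such that for all `y ∈ ℝ³`,
`∫_{|z| ≤ 2T} |f(z+y) - f(z)| / |z| dz ≤ C |y|^γ`. -/
theorem bessel_first_difference
    (α T γ : ℝ) (hα : 1 < α) (hT : 0 < T)
    (hγ0 : 0 < γ) (hγ : γ < min (α - 1) 1) :
    ∃ C : ℝ, 0 < C ∧ ∀ y : E3,
      (∫⁻ z in Metric.closedBall (0 : E3) (2 * T),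
          ENNReal.ofReal (|besselKernel α (z + y) - besselKernel α z| / ‖z‖))
        ≤ ENNReal.ofReal (C * ‖y‖ ^ γ) := by
  obtain ⟨hγα, hγ1⟩ := lt_min_iff.1 hγ
  obtain ⟨p, hpl, hp1⟩ : ∃ p, max 0 ((3 + γ - α) / 2) < p ∧ p < 1 :=
    exists_between (max_lt one_pos (by linarith))
  obtain ⟨hp0, hp⟩ := max_lt_iff.1 hpl
  obtain ⟨M, hM0, hM⟩ := exists_abs_besselKernel_sub_le hα hγ0 hγ1 hp0.le hp1.le hp
  set S := Metric.closedBall (0 : E3) (2 * T)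
  set N : E3 → ℝ≥0∞ := fun u => ENNReal.ofReal (‖u‖ ^ (-(2 * p + 1))) with hN
  have hNm : Measurable N := by fun_prop
  set J : ℝ≥0∞ := (∫⁻ u in Metric.ball (0 : E3) 1, N u) + volume S
  have hJtop : J ≠ ∞ := ENNReal.add_ne_top.2
    ⟨(lintegral_ball_norm_rpow_neg_lt_top (by linarith)).ne, measure_closedBall_lt_top.ne⟩
  have hNJ : ∀ y : E3, ∫⁻ z in S, N (z + y) ≤ J := fun y =>
    lintegral_norm_add_rpow_neg_le (by linarith) S y
  have hNJ0 : ∫⁻ z in S, N z ≤ J := by simpa using hNJ 0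
  refine ⟨M * (3 * J.toReal) + 1, by positivity, fun y => ?_⟩
  have hae : ∀ᵐ z ∂(volume.restrict S), z ≠ 0 ∧ z + y ≠ 0 := by
    refine ae_restrict_of_ae ?_
    filter_upwards [Measure.ae_ne volume (0 : E3), Measure.ae_ne volume (-y)] with z h1 h2
    exact ⟨h1, fun h => h2 (eq_neg_of_add_eq_zero_left h)⟩
  calc (∫⁻ z in S, ENNReal.ofReal (|besselKernel α (z + y) - besselKernel α z| / ‖z‖))
      ≤ ∫⁻ z in S, ENNReal.ofReal (M * ‖y‖ ^ γ) * (N (z + y) + (N z + N z)) := by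
        refine lintegral_mono_ae ?_
        filter_upwards [hae] with z hz
        have hz1 : 0 < ‖z‖ := norm_pos_iff.2 hz.1
        have hz2 : 0 < ‖z + y‖ := norm_pos_iff.2 hz.2
        simp only [hN]
        rw [← ENNReal.ofReal_add (by positivity) (by positivity),
          ← ENNReal.ofReal_add (by positivity) (by positivity),
          ← ENNReal.ofReal_mul (by positivity)]
        refine ENNReal.ofReal_le_ofReal ?_
        have h1 := rpow_neg_div_le (q := 2 * p) (by linarith) hz2 hz1
        have h2 : ‖z‖ ^ (-(2 * p)) / ‖z‖ = ‖z‖ ^ (-(2 * p + 1)) := by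
          rw [neg_add, rpow_add hz1, rpow_neg_one, div_eq_mul_inv]
        have h3 := hM (z + y) z hz.2 hz.1
        rw [add_sub_cancel_left] at h3
        calc _ ≤ M * ‖y‖ ^ γ * (‖z + y‖ ^ (-(2 * p)) + ‖z‖ ^ (-(2 * p))) / ‖z‖ := by gcongr
          _ = M * ‖y‖ ^ γ * (‖z + y‖ ^ (-(2 * p)) / ‖z‖ + ‖z‖ ^ (-(2 * p)) / ‖z‖) := by ring
          _ ≤ _ := by
            refine mul_le_mul_of_nonneg_left ?_ (by positivity)
            linarith
    _ = ENNReal.ofReal (M * ‖y‖ ^ γ) *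
          ((∫⁻ z in S, N (z + y)) + ((∫⁻ z in S, N z) + ∫⁻ z in S, N z)) := by
        rw [lintegral_const_mul _ (by fun_prop), lintegral_add_right _ (by fun_prop),
          lintegral_add_right _ (by fun_prop)]
    _ ≤ ENNReal.ofReal (M * ‖y‖ ^ γ) * (J + (J + J)) := by
        gcongr
        exact hNJ y
    _ = ENNReal.ofReal (M * ‖y‖ ^ γ) * ENNReal.ofReal (3 * J.toReal) := by
        rw [ENNReal.ofReal_mul zero_le_three, ENNReal.ofReal_toReal hJtop, ENNReal.ofReal_ofNat]
        ring
    _ = ENNReal.ofReal (M * (3 * J.toReal) * ‖y‖ ^ γ) := by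
        rw [← ENNReal.ofReal_mul (by positivity)]
        ring_nf
    _ ≤ _ := by
        refine ENNReal.ofReal_le_ofReal ?_
        gcongr
        linarith
end
end

section
/- Let α > 1, T > 0, let f be the Bessel kernel on ℝ³, and let 0 < ρ₂ < min(α−1, 2). Then there exists a constant C > 0 such that for all 0 < h ≤ 1, ∫₀^T ∫_{S²} ∫_{S²} |f(s(ξ+η) + h(ξ+η)) − f(s(ξ+η) + hξ) − f(s(ξ+η) + hη) + f(s(ξ+η))| s² σ(dξ) σ(dη) ds ≤ C h^{ρ₂}. -/
open MeasureTheory Real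
open scoped ENNReal

noncomputable section

lemma rpow_mul_exp_neg_le {m y : ℝ} (hm : 0 < m) (hy : 0 < y) :
    rexp (-y) ≤ m ^ m * y ^ (-m) := by
  have h1 : y / m ≤ rexp (y / m) := by linarith [Real.add_one_le_exp (y / m)]
  have h2 : (y / m) ^ m ≤ rexp (y / m) ^ m :=
    Real.rpow_le_rpow (by positivity) h1 hm.le
  rw [← Real.exp_mul, div_mul_cancel₀ _ hm.ne', Real.div_rpow hy.le hm.le,
    div_le_iff₀ (by positivity)] at h2
  rw [Real.exp_neg, Real.rpow_neg hy.le, ← div_eq_mul_inv, inv_eq_one_div,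
    div_le_div_iff₀ (Real.exp_pos y) (by positivity)]
  linarith

lemma one_sub_exp_neg_le_rpow {q y : ℝ} (hq0 : 0 ≤ q) (hq1 : q ≤ 1) (hy : 0 ≤ y) :
    1 - rexp (-y) ≤ y ^ q := by
  rcases le_total y 1 with h | h
  · have h1 : y ≤ y ^ q := by
      simpa using Real.rpow_le_rpow_of_exponent_ge_of_imp hy h hq1 (by intro h0 h1; linarith)
    linarith [Real.add_one_le_exp (-y)]
  · linarith [Real.one_le_rpow h hq0, Real.exp_pos (-y)]

/-- Pointwise bound for the mixed difference of the Gaussian `exp (-|x|² / (4 w))`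
at the points `a ξ + b η`, `a, b ∈ {s, s + h}`, where `g = (1 + ⟪ξ, η⟫) / (2 w)`. -/
lemma abs_gaussian_mixed_difference_le {β q w g s h : ℝ} (hβ : 0 < β) (hq0 : 0 < q) (hq1 : q ≤ 1)
    (hw : 0 < w) (hg : 0 < g) (hgw : g ≤ 1 / w) (hs : 0 < s) (hh : 0 < h) :
    |rexp (-(g * (s + h) ^ 2)) - 2 * rexp (-(g * (s * (s + h)) + h ^ 2 / (4 * w)))
        + rexp (-(g * s ^ 2))|
      ≤ (6 * β ^ β + 2 * (β + q) ^ (β + q)) * (g * s ^ 2) ^ (-β) * (h ^ 2 / w) ^ q := by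
  set x := g * s ^ 2 with hx
  have hx0 : 0 < x := by positivity
  set k := h ^ 2 / w with hk
  have hk0 : 0 < k := by positivity
  have hgh : g * h ^ 2 ≤ k := by
    rw [hk, div_eq_mul_one_div, mul_comm]; gcongr
  set A := rexp (-(g * (s * (s + h)))) with hA
  have hA0 : 0 < A := Real.exp_pos _
  have hAx : A ≤ rexp (-x) := by
    rw [hA, Real.exp_le_exp, hx]; nlinarith [mul_pos (mul_pos hg hs) hh]
  have e1 : rexp (-(g * (s * (s + h)) + h ^ 2 / (4 * w))) = A * rexp (-(k / 4)) := by
    rw [hA, ← Real.exp_add]; congr 1; rw [hk]; field_simp; ring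
  set p := rexp (-(g * h * s)) with hp
  set r := rexp (-(g * h ^ 2 / 2)) with hr
  have e2 : rexp (-(g * (s + h) ^ 2)) = rexp (-x) * (p * r) ^ 2 := by
    rw [hp, hr, ← Real.exp_add, ← Real.exp_nat_mul, ← Real.exp_add]; congr 1; rw [hx]
    push_cast; ring
  have e3 : rexp (-x) * (p * r) = A * r := by
    rw [hp, hr, hA, ← Real.exp_add, ← Real.exp_add, ← Real.exp_add]; congr 1; rw [hx]; ring
  have hp0 : 0 < p := Real.exp_pos _
  have hr0 : 0 < r := Real.exp_pos _
  have hp1 : p ≤ 1 := Real.exp_le_one_iff.2 (by have : 0 < g * h * s := by positivity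
                                                linarith)
  have hr1 : r ≤ 1 := Real.exp_le_one_iff.2 (by have : 0 < g * h ^ 2 := by positivity
                                                linarith)
  have hk1 : rexp (-(k / 4)) ≤ 1 := Real.exp_le_one_iff.2 (by linarith)
  have b1 : 1 - rexp (-(k / 4)) ≤ k ^ q :=
    (one_sub_exp_neg_le_rpow hq0.le hq1 (by positivity)).trans
      (Real.rpow_le_rpow (by positivity) (by linarith) hq0.le)
  have b2 : 1 - r ≤ k ^ q :=
    (one_sub_exp_neg_le_rpow hq0.le hq1 (by positivity)).trans
      (Real.rpow_le_rpow (by positivity) (by nlinarith [mul_pos hg (pow_pos hh 2)]) hq0.le)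
  have b3 : (1 - p) ^ 2 ≤ x ^ q * k ^ q := by
    have h1 : 1 - p ≤ (g * h * s) ^ q := one_sub_exp_neg_le_rpow hq0.le hq1 (by positivity)
    calc (1 - p) ^ 2 ≤ ((g * h * s) ^ q) ^ 2 := by
          apply pow_le_pow_left₀ (by linarith) h1
      _ = (x * (g * h ^ 2)) ^ q := by
          rw [sq, ← Real.mul_rpow (by positivity) (by positivity), hx]; ring_nf
      _ ≤ (x * k) ^ q := by gcongr
      _ = _ := Real.mul_rpow hx0.le hk0.le
  have c1 : rexp (-x) ≤ β ^ β * x ^ (-β) := rpow_mul_exp_neg_le hβ hx0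
  have c2 : rexp (-x) * x ^ q ≤ (β + q) ^ (β + q) * x ^ (-β) := by
    have := rpow_mul_exp_neg_le (m := β + q) (by positivity) hx0
    calc rexp (-x) * x ^ q ≤ (β + q) ^ (β + q) * x ^ (-(β + q)) * x ^ q := by gcongr
      _ = _ := by rw [mul_assoc, ← Real.rpow_add hx0]; ring_nf
  have key : rexp (-(g * (s + h) ^ 2)) - 2 * rexp (-(g * (s * (s + h)) + h ^ 2 / (4 * w)))
        + rexp (-x)
      = rexp (-x) * (1 - p * r) ^ 2 - 2 * A * (1 - r) + 2 * A * (1 - rexp (-(k / 4))) := by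
    rw [e1, e2]; linear_combination (2 : ℝ) * e3
  clear_value A p r k x
  have d0 : (1 - p * r) ^ 2 ≤ 2 * (x ^ q * k ^ q) + 2 * k ^ q := by
    have h0 := mul_nonneg (sub_nonneg.2 hp1) (sub_nonneg.2 hr1)
    have h1 : 1 - p * r ≤ (1 - p) + (1 - r) := by linarith only [h0]
    have h2 : 0 ≤ 1 - p * r := sub_nonneg.2 (mul_le_one₀ hp1 hr0.le hr1)
    have h3 : (1 - p * r) ^ 2 ≤ ((1 - p) + (1 - r)) ^ 2 := pow_le_pow_left₀ h2 h1 2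
    have h4 : (1 - r) ^ 2 ≤ 1 - r :=
      pow_le_of_le_one (sub_nonneg.2 hr1) (by linarith only [hr0]) two_ne_zero
    have h5 := sq_nonneg ((1 - p) - (1 - r))
    linarith only [h3, h4, h5, b2, b3]
  have d1 : rexp (-x) * (1 - p * r) ^ 2
      ≤ 2 * (rexp (-x) * x ^ q) * k ^ q + 2 * rexp (-x) * k ^ q := by
    refine (mul_le_mul_of_nonneg_left d0 (Real.exp_pos (-x)).le).trans_eq ?_
    ring
  have d2 : A * (1 - r) ≤ rexp (-x) * k ^ q :=
    mul_le_mul hAx b2 (by linarith) (Real.exp_pos _).le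
  have d3 : A * (1 - rexp (-(k / 4))) ≤ rexp (-x) * k ^ q :=
    mul_le_mul hAx b1 (by linarith) (Real.exp_pos _).le
  have d4 : 0 ≤ A * (1 - r) := mul_nonneg hA0.le (by linarith)
  have d5 : 0 ≤ A * (1 - rexp (-(k / 4))) := mul_nonneg hA0.le (by linarith)
  have d6 : 0 ≤ rexp (-x) * (1 - p * r) ^ 2 := by positivity
  have f1 : rexp (-x) * k ^ q ≤ β ^ β * x ^ (-β) * k ^ q := by gcongr
  have f2 : rexp (-x) * x ^ q * k ^ q ≤ (β + q) ^ (β + q) * x ^ (-β) * k ^ q := by gcongr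
  rw [key, abs_le]
  constructor <;> linarith only [d1, d2, d3, d4, d5, d6, f1, f2]

lemma integrableOn_besselIntegrand (α : ℝ) {a : ℝ} (ha : 0 < a) :
    IntegrableOn (fun w : ℝ => w ^ ((α - 5) / 2) * rexp (-w) * rexp (-a / (4 * w)))
      (Set.Ioi 0) := by
  obtain ⟨m, hm0, hm⟩ : ∃ m : ℝ, 0 < m ∧ 3 - α < 2 * m :=
    ⟨max 1 (3 - α), by positivity, by
      nlinarith [le_max_left 1 (3 - α), le_max_right 1 (3 - α)]⟩
  have hG := (Real.GammaIntegral_convergent (s := (α - 5) / 2 + m + 1)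
    (by linarith)).const_mul (m ^ m * (a / 4) ^ (-m))
  refine Integrable.mono' hG (Measurable.aestronglyMeasurable (by fun_prop)) ?_
  filter_upwards [ae_restrict_mem measurableSet_Ioi] with w (hw : 0 < w)
  rw [Real.norm_of_nonneg (by positivity)]
  have h1 := rpow_mul_exp_neg_le (m := m) (y := a / (4 * w)) hm0 (by positivity)
  have h2 : (a / (4 * w)) ^ (-m) = (a / 4) ^ (-m) * w ^ m := by
    rw [← div_div, Real.div_rpow (by positivity) hw.le, Real.rpow_neg hw.le m, div_inv_eq_mul]
  rw [h2] at h1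
  rw [neg_div]
  calc w ^ ((α - 5) / 2) * rexp (-w) * rexp (-(a / (4 * w)))
      ≤ w ^ ((α - 5) / 2) * rexp (-w) * (m ^ m * ((a / 4) ^ (-m) * w ^ m)) := by gcongr
    _ = _ := by
      rw [show (α - 5) / 2 + m + 1 - 1 = (α - 5) / 2 + m by ring, Real.rpow_add hw]; ring

lemma sphereMeasure_eq_smul_map : sphereMeasure =
    (3 : ℝ≥0∞) • ((volume : Measure E3).restrict (Metric.ball 0 1 \ {0})).map
      (fun x => ‖x‖⁻¹ • x) := by
  have hm : Measurable (fun x : E3 => ‖x‖⁻¹ • x) := by fun_prop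
  ext A hA
  rw [sphereMeasure, Measure.map_apply measurable_subtype_coe hA,
    Measure.toSphere_apply' _ (measurable_subtype_coe hA), Measure.smul_apply,
    Measure.map_apply hm hA, Measure.restrict_apply (hm hA)]
  simp only [finrank_euclideanSpace, Fintype.card_fin, smul_eq_mul, Nat.cast_ofNat]
  congr 2
  ext x
  simp only [Set.mem_smul, Set.mem_image, Set.mem_preimage, Subtype.exists, exists_and_left,
    Set.mem_Ioo, Set.mem_inter_iff, Set.mem_sdiff, Metric.mem_ball, dist_zero_right,
    Set.mem_singleton_iff, mem_sphere_iff_norm, sub_zero]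
  constructor
  · rintro ⟨r, ⟨hr0, hr1⟩, y, ⟨z, hz, hz1, rfl⟩, rfl⟩
    have : ‖r • z‖ = r := by rw [norm_smul, hz1, mul_one, Real.norm_of_nonneg hr0.le]
    refine ⟨?_, by rwa [this], ?_⟩
    · rwa [this, smul_smul, inv_mul_cancel₀ hr0.ne', one_smul]
    · rw [← norm_eq_zero, this]; exact hr0.ne'
  · rintro ⟨hx, h1, h0⟩
    have hx0 : ‖x‖ ≠ 0 := by rwa [norm_ne_zero_iff]
    refine ⟨‖x‖, ⟨by positivity, h1⟩, ‖x‖⁻¹ • x, ⟨_, hx, ?_, rfl⟩, ?_⟩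
    · rw [norm_smul, norm_inv, norm_norm, inv_mul_cancel₀ hx0]
    · rw [smul_smul, mul_inv_cancel₀ hx0, one_smul]

lemma ae_norm_eq_one_sphereMeasure : ∀ᵐ x ∂sphereMeasure, ‖x‖ = 1 := by
  rw [sphereMeasure, ae_map_iff measurable_subtype_coe.aemeasurable
    (measurableSet_eq_fun (by fun_prop) (by fun_prop))]
  exact .of_forall fun x => by simp

lemma integrable_indicator_abs_rpow {β : ℝ} (hβ : β < 1) :
    Integrable (Set.indicator (Set.Icc (-1 : ℝ) 1) fun t => |t| ^ (-β)) := by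
  have h1 : IntegrableOn (fun t : ℝ => |t| ^ (-β)) (Set.Ioc 0 1) := by
    have h := (intervalIntegral.intervalIntegrable_rpow' (a := 0) (b := 1) (r := -β)
      (by linarith)).1
    refine h.congr_fun (fun t ht => ?_) measurableSet_Ioc
    simp only [abs_of_pos ht.1]
  have h2 : IntegrableOn (fun t : ℝ => |t| ^ (-β)) (Set.Ico (-1) 0) := by
    have h := (Measure.measurePreserving_neg (volume : Measure ℝ)).integrableOn_comp_preimage
      (Homeomorph.neg ℝ).measurableEmbedding (f := fun t : ℝ => |t| ^ (-β)) (s := Set.Ioc 0 1)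
    have h' := h.2 h1
    simpa [Function.comp_def] using h'
  rw [integrable_indicator_iff measurableSet_Icc,
    ← Set.Ico_union_Icc_eq_Icc (by norm_num : (-1 : ℝ) ≤ 0) (by norm_num : (0 : ℝ) ≤ 1)]
  exact h2.union (integrableOn_Icc_iff_integrableOn_Ioc (by simp) |>.2 h1)

lemma abs_mul_abs_le_one_add_inner_normalize {x ξ : E3} (b : OrthonormalBasis (Fin 3) ℝ E3)
    (hb : b 0 = ξ) (hx1 : ‖x‖ < 1) (h1 : b.repr x 1 ≠ 0) :
    |b.repr x 1| * |b.repr x 2| ≤ 1 + inner ℝ ξ (‖x‖⁻¹ • x) := by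
  have hsum : ‖x‖ ^ 2 = b.repr x 0 ^ 2 + b.repr x 1 ^ 2 + b.repr x 2 ^ 2 := by
    rw [← b.repr.norm_map x, EuclideanSpace.norm_sq_eq, Fin.sum_univ_three]
    simp only [Real.norm_eq_abs, sq_abs]
  rw [real_inner_smul_right, ← hb, ← b.repr_apply_apply]
  generalize b.repr x 0 = y at *
  generalize b.repr x 1 = z at *
  generalize b.repr x 2 = v at *
  have ht0 : 0 ≤ ‖x‖ := norm_nonneg x
  generalize ‖x‖ = t at *
  have hz : 0 < z ^ 2 := by positivity
  have ht : 0 < t := by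
    rcases ht0.eq_or_lt with h | h
    · subst h; nlinarith [sq_nonneg y, sq_nonneg v]
    · exact h
  have hy : |y| < t := abs_lt_of_sq_lt_sq (by nlinarith [sq_nonneg v]) ht.le
  obtain ⟨hy1, hy2⟩ := abs_lt.1 hy
  have hzv : 2 * (|z| * |v|) ≤ z ^ 2 + v ^ 2 := by
    rw [← sq_abs z, ← sq_abs v]; nlinarith [sq_nonneg (|z| - |v|)]
  have hP : 0 ≤ |z| * |v| := by positivity
  generalize |z| * |v| = P at *
  have h2 : P ≤ t * (t + y) := by
    nlinarith [mul_nonneg (by linarith : 0 ≤ t + y) (by linarith : 0 ≤ t + y)]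
  have h3 : t * P ≤ t + y := by
    have : t * (t * P) ≤ t * (t + y) := by nlinarith [mul_nonneg ht.le hP]
    exact le_of_mul_le_mul_left this ht
  have h4 : 1 + t⁻¹ * y = (t + y) / t := by field_simp
  rw [h4, le_div_iff₀ ht]; linarith

lemma exists_orthonormalBasis_apply_zero_eq {ξ : E3} (hξ : ‖ξ‖ = 1) :
    ∃ b : OrthonormalBasis (Fin 3) ℝ E3, b 0 = ξ := by
  have hv : Orthonormal ℝ (({0} : Set (Fin 3)).domRestrict fun _ => ξ) := by
    refine ⟨fun _ => hξ, fun i j hij => absurd (Subsingleton.elim i j) hij⟩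
  obtain ⟨b, hb⟩ := hv.exists_orthonormalBasis_extension_of_card_eq (by simp)
  exact ⟨b, hb 0 rfl⟩

lemma exists_lintegral_one_add_inner_rpow_le {β : ℝ} (hβ0 : 0 < β) (hβ : β < 1) :
    ∃ K : ℝ≥0∞, K ≠ ∞ ∧ ∀ ξ : E3, ‖ξ‖ = 1 →
      ∫⁻ η, ENNReal.ofReal (1 + inner ℝ ξ η) ^ (-β) ∂sphereMeasure ≤ K := by
  set F : ℝ → ℝ := Set.indicator (Set.Icc (-1 : ℝ) 1) fun t => |t| ^ (-β) with hF
  have hFint : Integrable (fun y : Fin 3 → ℝ => ∏ i, F (y i)) :=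
    Integrable.fintype_prod (f := fun _ => F) fun _ => integrable_indicator_abs_rpow hβ
  have hFm : Measurable F := Measurable.indicator (by fun_prop) measurableSet_Icc
  refine ⟨3 * ∫⁻ y : Fin 3 → ℝ, ENNReal.ofReal (∏ i, F (y i)),
    ENNReal.mul_ne_top (by simp) hFint.lintegral_lt_top.ne, fun ξ hξ => ?_⟩
  obtain ⟨b, hb⟩ := exists_orthonormalBasis_apply_zero_eq hξ
  have hmp := (PiLp.volume_preserving_ofLp (Fin 3)).comp
    b.measurePreserving_repr
  rw [sphereMeasure_eq_smul_map, lintegral_smul_measure, lintegral_map (by fun_prop) (by fun_prop),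
    ← hmp.lintegral_comp (f := fun y : Fin 3 → ℝ => ENNReal.ofReal (∏ i, F (y i)))
      (by fun_prop), smul_eq_mul]
  refine mul_le_mul_right ?_ _
  rw [← lintegral_indicator (measurableSet_ball.diff (measurableSet_singleton _))]
  refine lintegral_mono_ae ?_
  have hne : ∀ᵐ y : Fin 3 → ℝ, ∀ i, y i ≠ 0 :=
    ae_all_iff.2 fun i => Measure.ae_eval_ne (μ := fun _ : Fin 3 => (volume : Measure ℝ)) i 0
  filter_upwards [hmp.quasiMeasurePreserving.ae hne] with x hx
  refine Set.indicator_apply_le' (fun hxb => ?_) fun _ => zero_le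
  have hx1 : ‖x‖ < 1 := by simpa using hxb.1
  have hx' : ∀ i, b.repr x i ≠ 0 := hx
  have hle : ∀ i, |b.repr x i| ≤ 1 := fun i => by
    have := (PiLp.norm_apply_le (b.repr x) i).trans (b.repr.norm_map x).le
    rw [Real.norm_eq_abs] at this
    linarith
  have hFx : ∀ i, F (b.repr x i) = |b.repr x i| ^ (-β) := fun i =>
    Set.indicator_of_mem (Set.mem_Icc.2 (abs_le.1 (hle i))) _
  have hpos : ∀ i, 0 < |b.repr x i| := fun i => abs_pos.2 (hx' i)
  have hu := abs_mul_abs_le_one_add_inner_normalize b hb hx1 (hx' 1)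
  have hP : 0 < |b.repr x 1| * |b.repr x 2| := mul_pos (hpos 1) (hpos 2)
  rw [ENNReal.ofReal_rpow_of_pos (hP.trans_le hu)]
  refine ENNReal.ofReal_le_ofReal ?_
  change _ ≤ ∏ i, F (b.repr x i)
  rw [Fin.prod_univ_three, hFx, hFx, hFx, mul_assoc, ← Real.mul_rpow (abs_nonneg _) (abs_nonneg _)]
  calc _ ≤ (|b.repr x 1| * |b.repr x 2|) ^ (-β) :=
        Real.rpow_le_rpow_of_nonpos hP hu (by linarith)
    _ ≤ _ := le_mul_of_one_le_left (by positivity)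
        (Real.one_le_rpow_of_pos_of_le_one_of_nonpos (hpos 0) (hle 0) (by linarith))

lemma norm_smul_add_smul_sq {ξ η : E3} (hξ : ‖ξ‖ = 1) (hη : ‖η‖ = 1) (a b : ℝ) :
    ‖a • ξ + b • η‖ ^ 2 = a ^ 2 + b ^ 2 + 2 * a * b * inner ℝ ξ η := by
  rw [norm_add_sq_real, norm_smul, norm_smul, hξ, hη, real_inner_smul_left, real_inner_smul_right]
  simp only [Real.norm_eq_abs, mul_one, sq_abs]
  ring

lemma besselKernel_eq_of_norm_sq {α a : ℝ} {x : E3} (h : ‖x‖ ^ 2 = a) :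
    besselKernel α x =
      ∫ w in Set.Ioi (0 : ℝ), w ^ ((α - 5) / 2) * rexp (-w) * rexp (-a / (4 * w)) := by
  rw [besselKernel, h]

lemma exists_abs_besselKernel_mixed_difference_le {α β q : ℝ} (hβ : 0 < β) (hq0 : 0 < q)
    (hq1 : q ≤ 1) (hα : 0 < (α - 5) / 2 + β - q + 1) :
    ∃ K : ℝ, 0 < K ∧ ∀ ξ η : E3, ‖ξ‖ = 1 → ‖η‖ = 1 → 0 < 1 + inner ℝ ξ η →
      ∀ s h : ℝ, 0 < s → 0 < h →
      |besselKernel α (s • (ξ + η) + h • (ξ + η))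
          - besselKernel α (s • (ξ + η) + h • ξ)
          - besselKernel α (s • (ξ + η) + h • η)
          + besselKernel α (s • (ξ + η))|
        ≤ K * (h ^ 2) ^ q * (s ^ 2) ^ (-β) * (1 + inner ℝ ξ η) ^ (-β) := by
  set M := (6 * β ^ β + 2 * (β + q) ^ (β + q)) * 2 ^ β with hM
  refine ⟨M * Real.Gamma ((α - 5) / 2 + β - q + 1),
    mul_pos (by positivity) (Real.Gamma_pos_of_pos hα), fun ξ η hξ hη hu s h hs hh => ?_⟩
  have hu2 : 1 + inner ℝ ξ η ≤ 2 := by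
    have := real_inner_le_norm ξ η
    rw [hξ, hη] at this; linarith
  obtain ⟨u, hu'⟩ : ∃ u : ℝ, u = 1 + inner ℝ ξ η := ⟨_, rfl⟩
  rw [← hu'] at hu hu2 ⊢
  have hin : inner ℝ ξ η = u - 1 := by linarith
  have n1 : ‖s • (ξ + η) + h • (ξ + η)‖ ^ 2 = 2 * (s + h) ^ 2 * u := by
    rw [← add_smul, smul_add, norm_smul_add_smul_sq hξ hη, hin]; ring
  have n2 : ‖s • (ξ + η) + h • ξ‖ ^ 2 = 2 * (s * (s + h)) * u + h ^ 2 := by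
    rw [show s • (ξ + η) + h • ξ = (s + h) • ξ + s • η by module,
      norm_smul_add_smul_sq hξ hη, hin]; ring
  have n3 : ‖s • (ξ + η) + h • η‖ ^ 2 = 2 * (s * (s + h)) * u + h ^ 2 := by
    rw [show s • (ξ + η) + h • η = s • ξ + (s + h) • η by module,
      norm_smul_add_smul_sq hξ hη, hin]; ring
  have n4 : ‖s • (ξ + η)‖ ^ 2 = 2 * s ^ 2 * u := by
    rw [smul_add, norm_smul_add_smul_sq hξ hη, hin]; ring
  rw [besselKernel_eq_of_norm_sq n1, besselKernel_eq_of_norm_sq n2,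
    besselKernel_eq_of_norm_sq n3, besselKernel_eq_of_norm_sq n4]
  have i1 := integrableOn_besselIntegrand α (a := 2 * (s + h) ^ 2 * u) (by positivity)
  have i2 := integrableOn_besselIntegrand α (a := 2 * (s * (s + h)) * u + h ^ 2) (by positivity)
  have i4 := integrableOn_besselIntegrand α (a := 2 * s ^ 2 * u) (by positivity)
  rw [← integral_sub' i1 i2, ← integral_sub' (i1.sub i2) i2, ← integral_add' ((i1.sub i2).sub i2) i4,
    ← Real.norm_eq_abs, Real.Gamma_eq_integral hα]
  have hR : M * (∫ w in Set.Ioi (0 : ℝ), rexp (-w) * w ^ ((α - 5) / 2 + β - q + 1 - 1))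
        * (h ^ 2) ^ q * (s ^ 2) ^ (-β) * u ^ (-β)
      = ∫ w in Set.Ioi (0 : ℝ), (M * (h ^ 2) ^ q * (s ^ 2) ^ (-β) * u ^ (-β))
          * (rexp (-w) * w ^ ((α - 5) / 2 + β - q + 1 - 1)) := by
    rw [integral_const_mul]; ring
  rw [hR]
  refine norm_integral_le_of_norm_le ((Real.GammaIntegral_convergent hα).const_mul _) ?_
  filter_upwards [ae_restrict_mem measurableSet_Ioi] with w (hw : 0 < w)
  have hD := abs_gaussian_mixed_difference_le (g := u / (2 * w)) hβ hq0 hq1 hw (by positivity)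
    (by rw [div_le_div_iff₀ (by positivity) hw]; nlinarith) hs hh
  have e1 : -(u / (2 * w) * (s + h) ^ 2) = -(2 * (s + h) ^ 2 * u) / (4 * w) := by
    field_simp; ring
  have e2 : -(u / (2 * w) * (s * (s + h)) + h ^ 2 / (4 * w))
      = -(2 * (s * (s + h)) * u + h ^ 2) / (4 * w) := by field_simp; ring
  have e4 : -(u / (2 * w) * s ^ 2) = -(2 * s ^ 2 * u) / (4 * w) := by field_simp; ring
  have hsplit : (u / (2 * w) * s ^ 2) ^ (-β) * (h ^ 2 / w) ^ q
      = 2 ^ β * ((h ^ 2) ^ q * (s ^ 2) ^ (-β) * u ^ (-β)) * w ^ (β - q) := by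
    rw [Real.mul_rpow (by positivity) (by positivity), Real.div_rpow hu.le (by positivity),
      Real.mul_rpow zero_le_two hw.le, Real.div_rpow (by positivity) hw.le,
      Real.rpow_neg zero_le_two, Real.rpow_neg hw.le, Real.rpow_sub hw]
    field_simp
  rw [e1, e2, e4, mul_assoc (_ + _) (_ ^ (-β)), hsplit] at hD
  have hpow : w ^ ((α - 5) / 2 + β - q + 1 - 1) = w ^ ((α - 5) / 2) * w ^ (β - q) := by
    rw [← Real.rpow_add hw]; ring_nf
  rw [hpow, Real.norm_eq_abs]
  calc _ = w ^ ((α - 5) / 2) * rexp (-w) * |rexp (-(2 * (s + h) ^ 2 * u) / (4 * w))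
          - 2 * rexp (-(2 * (s * (s + h)) * u + h ^ 2) / (4 * w))
          + rexp (-(2 * s ^ 2 * u) / (4 * w))| := by
        rw [← abs_of_pos (show 0 < w ^ ((α - 5) / 2) * rexp (-w) by positivity), ← abs_mul]
        congr 1
        simp only [Pi.add_apply, Pi.sub_apply]
        ring
    _ ≤ _ := mul_le_mul_of_nonneg_left hD (by positivity)
    _ = _ := by rw [hM]; ring

/-- Proposition 5.3, condition (4.2) for the Bessel kernel: for `α > 1` and
`0 < ρ₂ < min(α-1, 2)` there is `C > 0` such that for all `0 < h ≤ 1`,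
`∫₀^T ∫_{S²} ∫_{S²} |f(s(ξ+η)+h(ξ+η)) - f(s(ξ+η)+hξ) - f(s(ξ+η)+hη) + f(s(ξ+η))| s²
  σ(dξ) σ(dη) ds ≤ C h^{ρ₂}`. -/
theorem bessel_time_condition_two
    (α T ρ₂ : ℝ) (hα : 1 < α) (hT : 0 < T)
    (hρ0 : 0 < ρ₂) (hρ2 : ρ₂ < min (α - 1) 2) :
    ∃ C : ℝ, 0 < C ∧ ∀ h : ℝ, 0 < h → h ≤ 1 →
      (∫⁻ s in Set.Ioc (0 : ℝ) T, ∫⁻ ξ, ∫⁻ η,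
          ENNReal.ofReal
            (|besselKernel α (s • (ξ + η) + h • (ξ + η))
                - besselKernel α (s • (ξ + η) + h • ξ)
                - besselKernel α (s • (ξ + η) + h • η)
                + besselKernel α (s • (ξ + η))| * s ^ 2)
        ∂sphereMeasure ∂sphereMeasure)
      ≤ ENNReal.ofReal (C * h ^ ρ₂) := by
  have h1 := hρ2.trans_le (min_le_left _ _)
  have h2 := hρ2.trans_le (min_le_right _ _)
  obtain ⟨β, hβ, hβ1⟩ : ∃ β : ℝ, max 0 ((3 - α + ρ₂) / 2) < β ∧ β < 1 :=
    exists_between (max_lt one_pos (by linarith))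
  have hβ0 : 0 < β := (le_max_left _ _).trans_lt hβ
  have hβα : (3 - α + ρ₂) / 2 < β := (le_max_right _ _).trans_lt hβ
  obtain ⟨K, hK0, hK⟩ := exists_abs_besselKernel_mixed_difference_le (α := α) (q := ρ₂ / 2) hβ0
    (by linarith) (by linarith) (by linarith)
  obtain ⟨L, hLtop, hL⟩ := exists_lintegral_one_add_inner_rpow_le hβ0 hβ1
  set N : ℝ≥0∞ := L * sphereMeasure Set.univ with hN
  have hNtop : N ≠ ∞ := ENNReal.mul_ne_top hLtop (measure_ne_top _ _)
  set B : ℝ := K * (T ^ 2) ^ (1 - β) with hB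
  have hB0 : 0 < B := by positivity
  refine ⟨B * N.toReal * T + 1, by positivity, fun h hh _ => ?_⟩
  have hpt : ∀ s ∈ Set.Ioc 0 T, ∀ ξ η : E3, ‖ξ‖ = 1 → ‖η‖ = 1 →
      ENNReal.ofReal
        (|besselKernel α (s • (ξ + η) + h • (ξ + η)) - besselKernel α (s • (ξ + η) + h • ξ)
          - besselKernel α (s • (ξ + η) + h • η) + besselKernel α (s • (ξ + η))| * s ^ 2)
        ≤ ENNReal.ofReal (B * h ^ ρ₂) * ENNReal.ofReal (1 + inner ℝ ξ η) ^ (-β) := by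
    intro s hs ξ η hξ hη
    have hBh : 0 < B * h ^ ρ₂ := by positivity
    rcases le_or_gt (1 + inner ℝ ξ η) 0 with hu | hu
    · rw [ENNReal.ofReal_of_nonpos hu, ENNReal.zero_rpow_of_neg (by linarith),
        ENNReal.mul_top (by simpa using hBh)]
      exact le_top
    · rw [ENNReal.ofReal_rpow_of_pos hu, ← ENNReal.ofReal_mul hBh.le]
      refine ENNReal.ofReal_le_ofReal ?_
      have hs2 : 0 < s ^ 2 := pow_pos hs.1 2
      have e1 : (h ^ 2) ^ (ρ₂ / 2) = h ^ ρ₂ := by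
        rw [← Real.rpow_natCast_mul hh.le]; congr 1; push_cast; ring
      have e2 : (s ^ 2) ^ (-β) * s ^ 2 ≤ (T ^ 2) ^ (1 - β) := by
        calc (s ^ 2) ^ (-β) * s ^ 2 = (s ^ 2) ^ (1 - β) := by
              rw [← Real.rpow_add_one hs2.ne']; ring_nf
          _ ≤ _ := Real.rpow_le_rpow hs2.le (pow_le_pow_left₀ hs.1.le hs.2 2) (by linarith)
      have := hK ξ η hξ hη hu s h hs.1 hh
      rw [e1] at this
      calc _ ≤ K * h ^ ρ₂ * (s ^ 2) ^ (-β) * (1 + inner ℝ ξ η) ^ (-β) * s ^ 2 := by gcongr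
        _ = K * ((s ^ 2) ^ (-β) * s ^ 2) * h ^ ρ₂ * (1 + inner ℝ ξ η) ^ (-β) := by ring
        _ ≤ _ := by rw [hB]; gcongr
  calc _ ≤ ∫⁻ _ in Set.Ioc (0 : ℝ) T, ENNReal.ofReal (B * h ^ ρ₂) * N := by
        refine setLIntegral_mono' measurableSet_Ioc fun s hs => ?_
        calc _ ≤ ∫⁻ _, ENNReal.ofReal (B * h ^ ρ₂) * L ∂sphereMeasure := by
              refine lintegral_mono_ae ?_
              filter_upwards [ae_norm_eq_one_sphereMeasure] with ξ hξ
              calc _ ≤ ∫⁻ η, ENNReal.ofReal (B * h ^ ρ₂)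
                      * ENNReal.ofReal (1 + inner ℝ ξ η) ^ (-β) ∂sphereMeasure := by
                    refine lintegral_mono_ae ?_
                    filter_upwards [ae_norm_eq_one_sphereMeasure] with η hη
                    exact hpt s hs ξ η hξ hη
                _ = ENNReal.ofReal (B * h ^ ρ₂) * ∫⁻ η,
                      ENNReal.ofReal (1 + inner ℝ ξ η) ^ (-β) ∂sphereMeasure :=
                    lintegral_const_mul' _ _ ENNReal.ofReal_ne_top
                _ ≤ _ := mul_le_mul_right (hL ξ hξ) _
          _ = _ := by rw [lintegral_const, hN, mul_assoc]
    _ = ENNReal.ofReal (B * h ^ ρ₂ * N.toReal * T) := by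
        rw [setLIntegral_const, Real.volume_Ioc, sub_zero, ENNReal.ofReal_mul' hT.le,
          ENNReal.ofReal_mul' (q := N.toReal) ENNReal.toReal_nonneg, ENNReal.ofReal_toReal hNtop]
    _ ≤ _ := by
        refine ENNReal.ofReal_le_ofReal ?_
        have : 0 < h ^ ρ₂ := by positivity
        linarith
end
end

section
/- Let H₁, H₂, H₃ ∈ (1/2, 1) with H₁ + H₂ + H₃ > 2 and set κ̄ = H₁ + H₂ + H₃ − 2. Then there exists a constant C > 0 such that for all 0 < h ≤ 1, ∫_{|z| ≤ h} |z₁|^{2H₁−2} |z₂|^{2H₂−2} |z₃|^{2H₃−2} / |z| dz ≤ C h^{2κ̄}. -/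
open MeasureTheory Real
open scoped ENNReal

noncomputable section

/-- The fractional covariance kernel `f(z) = |z₁|^{2H₁-2} |z₂|^{2H₂-2} |z₃|^{2H₃-2}`. -/
def fracKernel (H₁ H₂ H₃ : ℝ) (z : E3) : ℝ :=
  |z 0| ^ (2 * H₁ - 2) * |z 1| ^ (2 * H₂ - 2) * |z 2| ^ (2 * H₃ - 2)

/-- `|x|^a` is interval integrable for `a > -1`. -/
theorem intervalIntegrable_abs_rpow {a : ℝ} (ha : -1 < a) (b c : ℝ) :
    IntervalIntegrable (fun x : ℝ => |x| ^ a) volume b c := by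
  refine intervalIntegrable_of_even (fun x => by rw [abs_neg]) (fun x hx => ?_)
  refine (intervalIntegral.intervalIntegrable_rpow' (a := 0) (b := x) ha).congr fun y hy => ?_
  rw [Set.uIoc_of_le hx.le] at hy
  simp only [abs_of_pos hy.1]

theorem integrableOn_Icc_abs_rpow {a : ℝ} (ha : -1 < a) {h : ℝ} (hh : 0 < h) :
    IntegrableOn (fun x : ℝ => |x| ^ a) (Set.Icc (-h) h) := by
  rw [integrableOn_Icc_iff_integrableOn_Ioc,
    ← intervalIntegrable_iff_integrableOn_Ioc_of_le (by linarith)]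
  exact intervalIntegrable_abs_rpow ha _ _

theorem integral_Icc_abs_rpow {a : ℝ} (ha : -1 < a) {h : ℝ} (hh : 0 < h) :
    ∫ x in Set.Icc (-h) h, |x| ^ a = 2 / (a + 1) * h ^ (a + 1) := by
  have hpos : ∫ x in (0 : ℝ)..h, |x| ^ a = h ^ (a + 1) / (a + 1) := by
    have hcongr : ∫ x in (0 : ℝ)..h, |x| ^ a = ∫ x in (0 : ℝ)..h, x ^ a := by
      refine intervalIntegral.integral_congr fun x hx => ?_
      rw [Set.uIcc_of_le hh.le] at hx
      simp only [abs_of_nonneg hx.1]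
    rw [hcongr, integral_rpow (Or.inl ha), Real.zero_rpow (by linarith), sub_zero]
  have hneg : ∫ x in (-h)..0, |x| ^ a = ∫ x in (0 : ℝ)..h, |x| ^ a := by
    have := intervalIntegral.integral_comp_neg (a := 0) (b := h) fun x : ℝ => |x| ^ a
    simpa using this.symm
  rw [integral_Icc_eq_integral_Ioc, ← intervalIntegral.integral_of_le (by linarith),
    ← intervalIntegral.integral_add_adjacent_intervals (b := 0)
      (intervalIntegrable_abs_rpow ha _ _) (intervalIntegrable_abs_rpow ha _ _), hneg, hpos]
  ring

/-- The integral over a centred cube of a product of powers of the coordinates. -/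
theorem lintegral_cube_prod_abs_rpow {ι : Type*} [Fintype ι] {a : ι → ℝ} (ha : ∀ i, -1 < a i)
    {h : ℝ} (hh : 0 < h) :
    ∫⁻ x in Set.univ.pi fun _ : ι => Set.Icc (-h) h, ENNReal.ofReal (∏ i, |x i| ^ a i)
      = ENNReal.ofReal (∏ i, 2 / (a i + 1) * h ^ (a i + 1)) := by
  rw [volume_pi, Measure.restrict_pi_pi, ← ofReal_integral_eq_lintegral_ofReal]
  · rw [integral_fintype_prod_eq_prod (fun i (x : ℝ) => |x| ^ a i)]
    simp only [integral_Icc_abs_rpow (ha _) hh]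
  · exact Integrable.fintype_prod (f := fun i (x : ℝ) => |x| ^ a i)
      fun i => integrableOn_Icc_abs_rpow (ha i) hh
  · exact Filter.Eventually.of_forall fun x => Finset.prod_nonneg fun i _ => by positivity

/-- Since `|zᵢ| ≤ |z|`, the factor `1 / |z|` can be distributed over the coordinates with weights
`w i` summing to one. -/
theorem prod_abs_rpow_div_norm_le {ι : Type*} [Fintype ι] {p w : ι → ℝ} (hp : ∀ i, p i ≠ 0)
    (hw : ∀ i, 0 ≤ w i) (hsum : ∑ i, w i = 1) (z : EuclideanSpace ℝ ι) :
    (∏ i, |z i| ^ p i) / ‖z‖ ≤ ∏ i, |z i| ^ (p i - w i) := by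
  by_cases hz : ∃ i, z i = 0
  · obtain ⟨i, hi⟩ := hz
    rw [Finset.prod_eq_zero (Finset.mem_univ i) (by rw [hi, abs_zero, Real.zero_rpow (hp i)]),
      zero_div]
    exact Finset.prod_nonneg fun i _ => by positivity
  push Not at hz
  have hnonempty : Nonempty ι := by
    by_contra hι
    rw [not_nonempty_iff] at hι
    simp at hsum
  have hle : ∀ i, |z i| ≤ ‖z‖ := fun i => PiLp.norm_apply_le z i
  have hnorm : 0 < ‖z‖ := (abs_pos.2 (hz hnonempty.some)).trans_le (hle _)
  have hinv : ‖z‖⁻¹ = ∏ i, ‖z‖ ^ (-w i) := by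
    rw [← Real.rpow_sum_of_pos hnorm, Finset.sum_neg_distrib, hsum, Real.rpow_neg_one]
  rw [div_eq_mul_inv, hinv, ← Finset.prod_mul_distrib]
  refine Finset.prod_le_prod (fun i _ => by positivity) fun i _ => ?_
  have hi : 0 < |z i| := abs_pos.2 (hz i)
  rw [sub_eq_add_neg, Real.rpow_add hi]
  exact mul_le_mul_of_nonneg_left
    (Real.rpow_le_rpow_of_nonpos hi (hle i) (neg_nonpos.2 (hw i))) (by positivity)

/-- Scaling bound for `∏ |zᵢ|^{pᵢ} / |z|` on Euclidean balls, given weights `w` summing to one with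
`pᵢ - wᵢ > -1`. -/
theorem lintegral_closedBall_prod_abs_rpow_div_norm_le {ι : Type*} [Fintype ι] {p w : ι → ℝ}
    (hp : ∀ i, p i ≠ 0) (hw : ∀ i, 0 ≤ w i) (hsum : ∑ i, w i = 1) (hpw : ∀ i, -1 < p i - w i)
    {h : ℝ} (hh : 0 < h) :
    ∫⁻ z in Metric.closedBall (0 : EuclideanSpace ℝ ι) h,
        ENNReal.ofReal ((∏ i, |z i| ^ p i) / ‖z‖)
      ≤ ENNReal.ofReal (∏ i, 2 / (p i - w i + 1) * h ^ (p i - w i + 1)) := by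
  rw [← lintegral_cube_prod_abs_rpow hpw hh,
    ← (EuclideanSpace.volume_preserving_symm_measurableEquiv_toLp ι).setLIntegral_comp_preimage_emb
      (MeasurableEquiv.measurableEmbedding _)]
  refine (lintegral_mono_set fun z hz => ?_).trans
    (lintegral_mono fun z => ENNReal.ofReal_le_ofReal (prod_abs_rpow_div_norm_le hp hw hsum z))
  rw [mem_closedBall_zero_iff] at hz
  exact fun i _ => abs_le.1 ((PiLp.norm_apply_le z i).trans hz)

/-- For the fractional kernel with `H₁+H₂+H₃ > 2` and `κ̄ = H₁+H₂+H₃-2`, there is `C > 0`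
such that `∫_{|z| ≤ h} f(z)/|z| dz ≤ C h^{2κ̄}` for all `0 < h ≤ 1`. -/
theorem frac_condition_one
    (H₁ H₂ H₃ κ : ℝ)
    (h₁ : H₁ ∈ Set.Ioo (1/2 : ℝ) 1) (h₂ : H₂ ∈ Set.Ioo (1/2 : ℝ) 1)
    (h₃ : H₃ ∈ Set.Ioo (1/2 : ℝ) 1)
    (hsum : 2 < H₁ + H₂ + H₃) (hκ : κ = H₁ + H₂ + H₃ - 2) :
    ∃ C : ℝ, 0 < C ∧ ∀ h : ℝ, 0 < h → h ≤ 1 →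
      (∫⁻ z in Metric.closedBall (0 : E3) h,
          ENNReal.ofReal (fracKernel H₁ H₂ H₃ z / ‖z‖))
        ≤ ENNReal.ofReal (C * h ^ (2 * κ)) := by
  obtain ⟨h₁l, h₁u⟩ := h₁
  obtain ⟨h₂l, h₂u⟩ := h₂
  obtain ⟨h₃l, h₃u⟩ := h₃
  set S : ℝ := 2 * (H₁ + H₂ + H₃) - 3 with hS
  have hS1 : 1 < S := by linarith
  have hS0 : 0 < S := by linarith
  set H : Fin 3 → ℝ := ![H₁, H₂, H₃] with hH
  have hl : ∀ i, 1 / 2 < H i := by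
    intro i; fin_cases i <;> assumption
  have hu : ∀ i, H i < 1 := by
    intro i; fin_cases i <;> assumption
  set p : Fin 3 → ℝ := fun i => 2 * H i - 2 with hp
  set w : Fin 3 → ℝ := fun i => (2 * H i - 1) / S with hw
  have hwsum : ∑ i, w i = 1 := by
    simp only [hw, hH, Fin.sum_univ_three, Matrix.cons_val]
    field_simp
    linarith
  have hpw : ∀ i, -1 < p i - w i := fun i => by
    have : (2 * H i - 1) / S < 2 * H i - 1 := div_lt_self (by linarith [hl i]) hS1
    simp only [hp, hw]
    linarith
  have hexp : ∑ i, (p i - w i + 1) = 2 * κ := by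
    rw [Finset.sum_add_distrib, Finset.sum_sub_distrib, hwsum]
    simp only [hp, hH, Fin.sum_univ_three, Matrix.cons_val]
    linarith
  refine ⟨∏ i, 2 / (p i - w i + 1),
    Finset.prod_pos fun i _ => div_pos two_pos (by linarith [hpw i]), fun h hh _ => ?_⟩
  rw [← hexp, Real.rpow_sum_of_pos hh, ← Finset.prod_mul_distrib]
  refine le_trans (le_of_eq ?_) (lintegral_closedBall_prod_abs_rpow_div_norm_le
    (p := p) (fun i => ne_of_lt (by simp only [hp]; linarith [hu i]))
    (fun i => div_nonneg (by linarith [hl i]) hS0.le) hwsum hpw hh)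
  simp only [fracKernel, Fin.prod_univ_three, hp, hH, Matrix.cons_val]
end
end

section
/- Let H₁, H₂, H₃ ∈ (1/2, 1) with H₁ + H₂ + H₃ > 2, set κ̄ = H₁ + H₂ + H₃ − 2, and let 0 < γ < min(H₁ − 1/2, κ̄). Then ∫_{ℝ³} |ξ₁|^{1−2(H₁−γ)} |ξ₂|^{1−2H₂} |ξ₃|^{1−2H₃} (1 + |ξ|²)⁻¹ dξ < ∞. -/
open MeasureTheory Real
open scoped ENNReal

noncomputable section

/-- The function `|x| ^ a * (1 + x ^ 2) ^ (-θ)` is integrable on the line as soon as it decays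
integrably at infinity and its singularity at the origin is integrable. -/
theorem integrable_abs_rpow_mul_one_add_sq_rpow {a θ : ℝ} (ha : -1 < a)
    (hdecay : a - 2 * θ < -1) :
    Integrable (fun x : ℝ ↦ |x| ^ a * (1 + x ^ 2) ^ (-θ)) := by
  have hmeas : Measurable (fun x : ℝ ↦ |x| ^ a * (1 + x ^ 2) ^ (-θ)) := by fun_prop
  have near : IntegrableOn (fun x : ℝ ↦ |x| ^ a * (1 + x ^ 2) ^ (-θ)) (Set.Ioc 0 1) := by
    have hpow : IntegrableOn (fun x : ℝ ↦ x ^ a) (Set.Ioc 0 1) :=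
      (intervalIntegrable_iff_integrableOn_Ioc_of_le zero_le_one).1
        (intervalIntegral.intervalIntegrable_rpow' ha)
    refine hpow.mono' hmeas.aestronglyMeasurable ?_
    filter_upwards [ae_restrict_mem measurableSet_Ioc] with x hx
    rw [norm_of_nonneg (by positivity), abs_of_pos hx.1]
    exact mul_le_of_le_one_right (rpow_nonneg hx.1.le a)
      (rpow_le_one_of_one_le_of_nonpos (by nlinarith [sq_nonneg x]) (by linarith))
  have far : IntegrableOn (fun x : ℝ ↦ |x| ^ a * (1 + x ^ 2) ^ (-θ)) (Set.Ioi 1) := by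
    refine (integrableOn_Ioi_rpow_of_lt hdecay zero_lt_one).mono' hmeas.aestronglyMeasurable ?_
    filter_upwards [ae_restrict_mem measurableSet_Ioi] with x hx
    have hx0 : 0 < x := zero_lt_one.trans hx
    rw [norm_of_nonneg (by positivity), abs_of_pos hx0]
    have hsplit : x ^ (a - 2 * θ) = x ^ a * (x ^ 2) ^ (-θ) := by
      rw [← rpow_natCast x 2, ← rpow_mul hx0.le, ← rpow_add hx0]
      congr 1
      push_cast
      ring
    rw [hsplit]
    exact mul_le_mul_of_nonneg_left
      (rpow_le_rpow_of_nonpos (by positivity) (by linarith) (by linarith)) (by positivity)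
  have pos : IntegrableOn (fun x : ℝ ↦ |x| ^ a * (1 + x ^ 2) ^ (-θ)) (Set.Ioi 0) := by
    rw [← Set.Ioc_union_Ioi_eq_Ioi zero_le_one]
    exact near.union far
  have neg : IntegrableOn (fun x : ℝ ↦ |x| ^ a * (1 + x ^ 2) ^ (-θ)) (Set.Iic 0) := by
    rw [← neg_zero] at pos
    simpa using pos.comp_neg_Iio.congr_set_ae Iio_ae_eq_Iic.symm
  rw [← integrableOn_univ, ← Set.Iic_union_Ioi (a := (0 : ℝ))]
  exact neg.union pos

/-- A weighted form of the arithmetic-geometric mean inequality, bounding the inverse of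
`1 + ‖ξ‖ ^ 2` by a product of functions of one coordinate each. -/
theorem inv_one_add_norm_sq_le_prod_rpow {ι : Type*} [Fintype ι] (ξ : EuclideanSpace ℝ ι)
    (θ : ι → ℝ) (hθ : ∀ i, 0 ≤ θ i) (hsum : ∑ i, θ i = 1) :
    (1 + ‖ξ‖ ^ 2)⁻¹ ≤ ∏ i, (1 + ξ i ^ 2) ^ (-θ i) := by
  have hcoord (i : ι) : ξ i ^ 2 ≤ ‖ξ‖ ^ 2 := by
    rw [EuclideanSpace.real_norm_sq_eq]
    exact Finset.single_le_sum (f := fun j ↦ ξ j ^ 2) (fun j _ ↦ sq_nonneg _) (Finset.mem_univ i)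
  calc (1 + ‖ξ‖ ^ 2)⁻¹ = ∏ i, (1 + ‖ξ‖ ^ 2) ^ (-θ i) := by
        rw [← rpow_sum_of_pos (by positivity), Finset.sum_neg_distrib, hsum, rpow_neg_one]
    _ ≤ ∏ i, (1 + ξ i ^ 2) ^ (-θ i) :=
        Finset.prod_le_prod (fun i _ ↦ by positivity) fun i _ ↦
          rpow_le_rpow_of_nonpos (by positivity) (by linarith [hcoord i]) (by linarith [hθ i])

/-- A product of powers of the coordinates, divided by `1 + ‖ξ‖ ^ 2`, is integrable when each
singularity is integrable and the total exponent gives enough decay at infinity. -/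
theorem integrable_prod_abs_rpow_mul_inv_one_add_norm_sq {ι : Type*} [Fintype ι] [Nonempty ι]
    (a : ι → ℝ) (ha : ∀ i, -1 < a i) (hsum : ∑ i, (a i + 1) < 2) :
    Integrable (fun ξ : EuclideanSpace ℝ ι ↦ (∏ i, |ξ i| ^ a i) * (1 + ‖ξ‖ ^ 2)⁻¹) := by
  have hcard : (0 : ℝ) < Fintype.card ι := by exact_mod_cast Fintype.card_pos
  set ε : ℝ := (1 - (∑ i, (a i + 1)) / 2) / Fintype.card ι with hε
  have hε0 : 0 < ε := div_pos (by linarith) hcard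
  set θ : ι → ℝ := fun i ↦ (a i + 1) / 2 + ε with hθ
  have hθ0 (i : ι) : 0 ≤ θ i := by simp only [hθ]; linarith [ha i]
  have hθ1 : ∑ i, θ i = 1 := by
    simp only [hθ]
    rw [Finset.sum_add_distrib, ← Finset.sum_div, Finset.sum_const, Finset.card_univ,
      nsmul_eq_mul, hε, mul_div_cancel₀ _ hcard.ne']
    ring
  have hprod : Integrable
      (fun x : ι → ℝ ↦ ∏ i, |x i| ^ a i * (1 + x i ^ 2) ^ (-θ i)) :=
    Integrable.fintype_prod (f := fun i (x : ℝ) ↦ |x| ^ a i * (1 + x ^ 2) ^ (-θ i)) fun i ↦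
      integrable_abs_rpow_mul_one_add_sq_rpow (ha i) (by simp only [hθ]; linarith)
  refine ((PiLp.volume_preserving_ofLp ι).integrable_comp_of_integrable hprod).mono'
    (Measurable.aestronglyMeasurable (by fun_prop)) (.of_forall fun ξ ↦ ?_)
  rw [norm_of_nonneg (by positivity), Function.comp_apply, Finset.prod_mul_distrib]
  exact mul_le_mul_of_nonneg_left (inv_one_add_norm_sq_le_prod_rpow ξ θ hθ0 hθ1) (by positivity)

/-- Integrability condition in the proof of Theorem 6.1: for `H₁, H₂, H₃ ∈ (1/2, 1)` with
`H₁+H₂+H₃ > 2`, `κ̄ = H₁+H₂+H₃-2` and `0 < γ < min(H₁ - 1/2, κ̄)`,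
`∫_{ℝ³} |ξ₁|^{1-2(H₁-γ)} |ξ₂|^{1-2H₂} |ξ₃|^{1-2H₃} (1+|ξ|²)⁻¹ dξ < ∞`. -/
theorem frac_spectral_integrability
    (H₁ H₂ H₃ κ γ : ℝ)
    (h₁ : H₁ ∈ Set.Ioo (1/2 : ℝ) 1) (h₂ : H₂ ∈ Set.Ioo (1/2 : ℝ) 1)
    (h₃ : H₃ ∈ Set.Ioo (1/2 : ℝ) 1)
    (hsum : 2 < H₁ + H₂ + H₃) (hκ : κ = H₁ + H₂ + H₃ - 2)
    (hγ0 : 0 < γ) (hγ : γ < min (H₁ - 1/2) κ) :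
    ∫⁻ ξ : E3, ENNReal.ofReal
        (|ξ 0| ^ (1 - 2 * (H₁ - γ)) * |ξ 1| ^ (1 - 2 * H₂) * |ξ 2| ^ (1 - 2 * H₃)
          * (1 + ‖ξ‖ ^ 2)⁻¹) ≠ ∞ := by
  obtain ⟨-, hγκ⟩ := lt_min_iff.1 hγ
  have hint := integrable_prod_abs_rpow_mul_inv_one_add_norm_sq
    ![1 - 2 * (H₁ - γ), 1 - 2 * H₂, 1 - 2 * H₃]
    (by
      intro i
      fin_cases i
      · simpa using by linarith [h₁.2]
      · simpa using by linarith [h₂.2]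
      · simpa using by linarith [h₃.2])
    (by simp [Fin.sum_univ_three]; linarith)
  simpa [Fin.prod_univ_three] using hint.lintegral_lt_top.ne
end
end
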